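/- Assume K > R(R+1)(d−1). Let p be a prime, ν ∈ ℤ^R, and suppose x_0 ∈ ℤ_p^n satisfies f_i(x_0) = ν_i for all i and max_{I ⊆ {1,…,n}, |I| = R} |Δ_I(x_0)|_p > 0. Then the local density satisfies 𝔖_p(ν) ≥ (p^{−1} · max_{I} |Δ_I(x_0)|_p^2)^{n−R}. -/

import Mathlib

open MeasureTheory Filter MvPolynomial

noncomputable section

/-- `e t = exp (2 π i t)` -/
def eC (t : ℝ) : ℂ := Complex.exp (2 * (Real.pi : ℂ) * Complex.I * (t : ℂ))

abbrev Qbar : Type := AlgebraicClosure ℚ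

/-- Dimension of the affine singular locus of `g` (the common zero set of the partial
derivatives of `g`), as the Krull dimension of its coordinate ring. -/
def singDim (n : ℕ) (g : MvPolynomial (Fin n) Qbar) : WithBot ℕ∞ :=
  ringKrullDim (MvPolynomial (Fin n) Qbar ⧸
    Ideal.span (Set.range fun j : Fin n => MvPolynomial.pderiv j g))

/-- `Δ = max_{b ∈ ℤ^R \ {0}} dim Sing(b₁ g₁ + ⋯ + b_R g_R)`. -/
def birchDelta (n R : ℕ) (g : Fin R → MvPolynomial (Fin n) ℤ) : WithBot ℕ∞ :=
  ⨆ (b : Fin R → ℤ) (_ : b ≠ 0),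
    singDim n (MvPolynomial.map (Int.castRingHom Qbar) (∑ i, b i • g i))

/-- `K = (n - Δ)/2^(d-1)` where `Δ = max_{b ≠ 0} dim Sing(f̃_b)`. -/
def KofDelta (n R d : ℕ) (g : Fin R → MvPolynomial (Fin n) ℤ) (K : ℝ) : Prop :=
  ∃ Δ : ℕ, ((Δ : ℕ∞) : WithBot ℕ∞) = birchDelta n R g ∧
    K = ((n : ℝ) - (Δ : ℝ)) / 2 ^ (d - 1)

/-- The quantity `R(R+1)(d-1)` as a real number. -/
def BB (R d : ℕ) : ℝ := (R : ℝ) * ((R : ℝ) + 1) * ((d : ℝ) - 1)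

/-- The `R × R` minor of the Jacobian matrix of `f` with columns given by the elements
of `I`. -/
def jacMinor {n R : ℕ} (f : Fin R → MvPolynomial (Fin n) ℤ)
    (I : Finset (Fin n)) (hI : I.card = R) : MvPolynomial (Fin n) ℤ :=
  Matrix.det (Matrix.of fun i k : Fin R => MvPolynomial.pderiv (I.orderEmbOfFin hI k) (f i))

/-- `Cv` is the maximum of the absolute values of the coefficients of the `f i`. -/
def coeffMax {n R : ℕ} (f : Fin R → MvPolynomial (Fin n) ℤ) (Cv : ℝ) : Prop :=
  IsGreatest {x : ℝ | ∃ (i : Fin R) (m : (Fin n) →₀ ℕ), x = |((MvPolynomial.coeff m (f i) : ℤ) : ℝ)|} Cv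

/-- The integer points of the dilated box `P𝓑`. -/
def boxPts {n : ℕ} (aB bB : Fin n → ℝ) (P : ℝ) : Finset (Fin n → ℤ) :=
  Finset.Icc (fun j => ⌈P * aB j⌉) (fun j => ⌊P * bB j⌋)

/-- The exponential sum `S(α) = ∑_{x ∈ P𝓑 ∩ ℤ^n} e(α · f(x))`. -/
def Sexp {n R : ℕ} (f : Fin R → MvPolynomial (Fin n) ℤ) (aB bB : Fin n → ℝ) (P : ℝ)
    (α : Fin R → ℝ) : ℂ :=
  ∑ x ∈ boxPts aB bB P, eC (∑ i, α i * (MvPolynomial.eval x (f i) : ℝ))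

/-- The complete exponential sum `S_{a,q} = ∑_{x mod q} e(a · f(x)/q)`. -/
def Sgauss {n R : ℕ} (f : Fin R → MvPolynomial (Fin n) ℤ) (q : ℕ) (a : Fin R → ℤ) : ℂ :=
  ∑ x : Fin n → Fin q,
    eC ((∑ i, (a i : ℝ) * (MvPolynomial.eval (fun j => ((x j : ℕ) : ℤ)) (f i) : ℝ)) / q)

/-- `S_{a,q}(ν) = S_{a,q} e(-a·ν/q)`. -/
def SgaussNu {n R : ℕ} (f : Fin R → MvPolynomial (Fin n) ℤ) (q : ℕ) (a : Fin R → ℤ)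
    (ν : Fin R → ℤ) : ℂ :=
  Sgauss f q a * eC (-(∑ i, (a i : ℝ) * (ν i : ℝ)) / q)

/-- Residues `1 ≤ aᵢ ≤ q` (coded by `Fin q`, shifted by one) with `gcd(a₁, …, a_R, s) = 1`. -/
def resSet (R q s : ℕ) : Finset (Fin R → Fin q) :=
  Finset.univ.filter fun a => Nat.gcd (Finset.univ.gcd fun i => (a i : ℕ) + 1) s = 1

/-- The singular series `𝔖(ν)`. -/
def singularSeries {n R : ℕ} (f : Fin R → MvPolynomial (Fin n) ℤ) (ν : Fin R → ℤ) : ℂ :=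
  ∑' q : ℕ, ((q : ℂ) ^ n)⁻¹ *
    ∑ a ∈ resSet R q q, SgaussNu f q (fun i => ((a i : ℕ) : ℤ) + 1) ν

/-- The local density `𝔖_p(ν)`. -/
def localDensity {n R : ℕ} (f : Fin R → MvPolynomial (Fin n) ℤ) (ν : Fin R → ℤ) (p : ℕ) : ℂ :=
  ∑' r : ℕ, ((p : ℂ) ^ (r * n))⁻¹ *
    ∑ a ∈ resSet R (p ^ r) p, SgaussNu f (p ^ r) (fun i => ((a i : ℕ) : ℤ) + 1) ν

/-- The box `𝓑 = ∏ⱼ [aⱼ, bⱼ]` as a subset of `ℝ^n`. -/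
def boxSet {n : ℕ} (aB bB : Fin n → ℝ) : Set (Fin n → ℝ) :=
  Set.univ.pi fun j => Set.Icc (aB j) (bB j)

/-- The oscillatory integral `I(𝓒, γ) = ∫_{ζ ∈ 𝓒} e(γ · g(ζ)) dζ`. -/
def Iosc {n R : ℕ} (g : Fin R → MvPolynomial (Fin n) ℤ) (C : Set (Fin n → ℝ))
    (γ : Fin R → ℝ) : ℂ :=
  ∫ ζ in C, eC (∑ i, γ i * MvPolynomial.aeval ζ (g i))

/-- `J(μ, Φ) = ∫_{|γ| ≤ Φ} I(𝓑, γ) e(-γ·μ) dγ`. -/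
def Jint {n R : ℕ} (g : Fin R → MvPolynomial (Fin n) ℤ) (aB bB : Fin n → ℝ)
    (μ : Fin R → ℝ) (Φ : ℝ) : ℂ :=
  ∫ γ in {γ : Fin R → ℝ | ∀ i, |γ i| ≤ Φ}, Iosc g (boxSet aB bB) γ * eC (-(∑ i, γ i * μ i))

/-- The singular integral `J(μ) = lim_{Φ → ∞} J(μ, Φ)`. -/
def Jlim {n R : ℕ} (g : Fin R → MvPolynomial (Fin n) ℤ) (aB bB : Fin n → ℝ)
    (μ : Fin R → ℝ) : ℂ :=
  limUnder Filter.atTop fun Φ : ℝ => Jint g aB bB μ Φ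

/-- `M(P, ν)`: the number of integer points `x ∈ P𝓑` with `f(x) = ν`. -/
def Mcount {n R : ℕ} (f : Fin R → MvPolynomial (Fin n) ℤ) (aB bB : Fin n → ℝ) (P : ℝ)
    (ν : Fin R → ℤ) : ℕ :=
  ((boxPts aB bB P).filter fun x => ∀ i, MvPolynomial.eval x (f i) = ν i).card

/-- A single major arc `𝔐_{a,q}(θ)`. -/
def majorArc {R : ℕ} (d : ℕ) (Ct P θ : ℝ) (q : ℕ) (a : Fin R → ℤ) : Set (Fin R → ℝ) :=
  Set.univ.pi fun i => Set.Icc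
    ((a i : ℝ) / q - Ct ^ (R - 1) * P ^ (-(d : ℝ) + (R : ℝ) * ((d : ℝ) - 1) * θ) / (2 * q))
    ((a i : ℝ) / q + Ct ^ (R - 1) * P ^ (-(d : ℝ) + (R : ℝ) * ((d : ℝ) - 1) * θ) / (2 * q))

/-- The major arcs `𝔐(θ)`. -/
def majorArcs (R d : ℕ) (Ct P θ : ℝ) : Set (Fin R → ℝ) :=
  ⋃ (q : ℕ) (_ : 1 ≤ q ∧ (q : ℝ) ≤ Ct ^ R * P ^ ((R : ℝ) * ((d : ℝ) - 1) * θ))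
    (a : Fin R → ℤ)
    (_ : (∀ i, 1 ≤ a i ∧ a i ≤ (q : ℤ)) ∧ Int.gcd (Finset.univ.gcd a) (q : ℤ) = 1),
    majorArc d Ct P θ q a

/-- The minor arcs `𝔪 = [0,1]^R \ 𝔐(θ)`, taken modulo `1`. -/
def minorArcs (R d : ℕ) (Ct P θ : ℝ) : Set (Fin R → ℝ) :=
  {α | (∀ i, 0 ≤ α i ∧ α i ≤ 1) ∧
    ∀ z : Fin R → ℤ, (fun i => α i + (z i : ℝ)) ∉ majorArcs R d Ct P θ}

/-- Nonsingularity of the affine variety `f = 0` over `ℚ̄`: at every common zero the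
Jacobian matrix has (maximal) rank `R`, i.e. some `R × R` minor is nonvanishing. -/
def AffineNonsingular {n : ℕ} (R : ℕ) (f : Fin R → MvPolynomial (Fin n) ℤ) : Prop :=
  ∀ x : Fin n → Qbar, (∀ i, MvPolynomial.aeval x (f i) = 0) →
    ∃ (I : Finset (Fin n)) (hI : I.card = R), MvPolynomial.aeval x (jacMinor f I hI) ≠ 0

/-- Nonsingularity of the projective variety `g = 0` over `ℚ̄` (for forms `g`): at every
nonzero point of the affine cone the Jacobian matrix has rank `R`. -/
def ProjNonsingular {n : ℕ} (R : ℕ) (g : Fin R → MvPolynomial (Fin n) ℤ) : Prop :=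
  ∀ x : Fin n → Qbar, x ≠ 0 → (∀ i, MvPolynomial.aeval x (g i) = 0) →
    ∃ (I : Finset (Fin n)) (hI : I.card = R), MvPolynomial.aeval x (jacMinor g I hI) ≠ 0


namespace LD

/-- Polynomials all of whose monomials have degree `< m`. -/
def VV (n : ℕ) (S : Type*) [CommRing S] (m : ℕ) : Submodule S (MvPolynomial (Fin n) S) :=
  MvPolynomial.restrictSupport S {s : Fin n →₀ ℕ | s.degree < m}

theorem mem_VV {n : ℕ} {S : Type*} [CommRing S] {m : ℕ} {P : MvPolynomial (Fin n) S} :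
    P ∈ VV n S m ↔ ∀ s : Fin n →₀ ℕ, P.coeff s ≠ 0 → s.degree < m := by
  simp [VV, mem_restrictSupport_iff, Set.subset_def]

theorem VV_mono {n : ℕ} {S : Type*} [CommRing S] {a b : ℕ} (h : a ≤ b) :
    VV n S a ≤ VV n S b := by
  intro P hP
  rw [mem_VV] at *
  intro s hs
  exact lt_of_lt_of_le (hP s hs) h

theorem VV_zero {n : ℕ} {S : Type*} [CommRing S] {P : MvPolynomial (Fin n) S}
    (h : P ∈ VV n S 0) : P = 0 := by
  rw [mem_VV] at h
  ext s
  by_contra hs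
  exact absurd (h s hs) (by omega)

theorem VV_mul {n : ℕ} {S : Type*} [CommRing S] {a b : ℕ} {P Q : MvPolynomial (Fin n) S}
    (hP : P ∈ VV n S (a + 1)) (hQ : Q ∈ VV n S b) : P * Q ∈ VV n S (a + b) := by
  classical
  rw [mem_VV] at *
  intro s hs
  rw [coeff_mul] at hs
  obtain ⟨x, hx, hne⟩ := Finset.exists_ne_zero_of_sum_ne_zero hs
  have h1 := hP x.1 (left_ne_zero_of_mul hne)
  have h2 := hQ x.2 (right_ne_zero_of_mul hne)
  rw [Finset.HasAntidiagonal.mem_antidiagonal] at hx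
  rw [← hx, map_add]
  omega

theorem VV_C {n : ℕ} {S : Type*} [CommRing S] (c : S) :
    (C c : MvPolynomial (Fin n) S) ∈ VV n S 1 := by
  classical
  rw [mem_VV]
  intro s hs
  rw [coeff_C] at hs
  have : 0 = s := by by_contra h; simp [h] at hs
  simp [← this]

theorem VV_X {n : ℕ} {S : Type*} [CommRing S] (i : Fin n) :
    (X i : MvPolynomial (Fin n) S) ∈ VV n S 2 := by
  classical
  rw [mem_VV]
  intro s hs
  rw [coeff_X] at hs
  have : Finsupp.single i 1 = s := by by_contra h; simp [h] at hs
  simp [← this]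

theorem VV_pderiv {n : ℕ} {S : Type*} [CommRing S] {m : ℕ} {P : MvPolynomial (Fin n) S}
    (hP : P ∈ VV n S (m + 1)) (i : Fin n) : pderiv i P ∈ VV n S m := by
  rw [mem_VV] at *
  intro s hs
  rw [coeff_pderiv] at hs
  have := hP _ (left_ne_zero_of_mul hs)
  simp at this
  omega

theorem VV_of_totalDegree {n : ℕ} {S : Type*} [CommRing S] {m : ℕ} {P : MvPolynomial (Fin n) S}
    (hP : P.totalDegree ≤ m) : P ∈ VV n S (m + 1) := by
  rw [mem_VV]
  intro s hs
  have := le_totalDegree (mem_support_iff.2 hs)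
  have h2 : s.degree = s.sum fun _ e => e := by
    rfl
  omega

theorem VV_map {n : ℕ} {S T : Type*} [CommRing S] [CommRing T] (φ : S →+* T) {m : ℕ}
    {P : MvPolynomial (Fin n) S} (hP : P ∈ VV n S m) : map φ P ∈ VV n T m := by
  rw [mem_VV] at *
  intro s hs
  apply hP
  rw [coeff_map] at hs
  intro h
  simp [h] at hs

/-- shift -/
def tau {n : ℕ} {S : Type*} [CommRing S] (h : Fin n → S) :
    MvPolynomial (Fin n) S →ₐ[S] MvPolynomial (Fin n) S :=
  aeval fun i => X i + C (h i)

/-- directional derivative -/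
def dirD {n : ℕ} {S : Type*} [CommRing S] (h : Fin n → S) (P : MvPolynomial (Fin n) S) :
    MvPolynomial (Fin n) S := ∑ i, h i • pderiv i P

theorem dirD_mul_X {n : ℕ} {S : Type*} [CommRing S] (h : Fin n → S) (P : MvPolynomial (Fin n) S)
    (i : Fin n) : dirD h (P * X i) = dirD h P * X i + h i • P := by
  classical
  simp only [dirD, pderiv_mul, smul_add, Finset.sum_add_distrib, Finset.sum_mul, smul_mul_assoc]
  congr 1
  rw [Finset.sum_eq_single i]
  · simp
  · intro j _ hj
    rw [pderiv_X_of_ne hj.symm]; simp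
  · simp

theorem mul_X_mem_VV {n : ℕ} {S : Type*} [CommRing S] {a b : ℕ} {P : MvPolynomial (Fin n) S}
    (hP : P ∈ VV n S a) (i : Fin n) (h : a = 0 ∨ a + 1 ≤ b) : P * X i ∈ VV n S b := by
  rcases h with rfl | h
  · rw [VV_zero hP]; simp
  · rw [mul_comm]
    exact VV_mono (by omega) (VV_mul (VV_X i) hP)

theorem VV_of_mul_X {n : ℕ} {S : Type*} [CommRing S] {m : ℕ} {P : MvPolynomial (Fin n) S}
    {i : Fin n} (hP : P * X i ∈ VV n S m) : P ∈ VV n S (m - 1) := by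
  rw [mem_VV] at *
  intro s hs
  have := hP (s + Finsupp.single i 1) (by rwa [coeff_mul_X])
  simp at this
  omega

theorem tau_VV {n : ℕ} {S : Type*} [CommRing S] (h : Fin n → S) (m : ℕ)
    (P : MvPolynomial (Fin n) S) (hP : P ∈ VV n S m) :
    tau h P - P ∈ VV n S (m - 1) ∧ tau h P - P - dirD h P ∈ VV n S (m - 2) := by
  have key : ∀ (s : Fin n →₀ ℕ) (a : S), ∀ m, monomial s a ∈ VV n S m →
      tau h (monomial s a) - monomial s a ∈ VV n S (m - 1) ∧
      tau h (monomial s a) - monomial s a - dirD h (monomial s a) ∈ VV n S (m - 2) := by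
    intro s a
    refine MvPolynomial.induction_on_monomial (motive := fun P => ∀ m, P ∈ VV n S m →
      tau h P - P ∈ VV n S (m - 1) ∧ tau h P - P - dirD h P ∈ VV n S (m - 2)) ?_ ?_ s a
    · intro a m _
      simp [tau, dirD]
    · intro P i ih m hm
      obtain ⟨h1, h2⟩ := ih _ (VV_of_mul_X hm)
      have e1 : tau h (P * X i) - P * X i = (tau h P - P) * X i + h i • (tau h P - P) + h i • P := by
        simp only [tau, map_mul, aeval_X, smul_eq_C_mul]; ring
      have e2 : tau h (P * X i) - P * X i - dirD h (P * X i) =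
          (tau h P - P - dirD h P) * X i + h i • (tau h P - P) := by
        rw [e1, dirD_mul_X]; ring
      rw [e2, e1]
      constructor
      · refine add_mem (add_mem (mul_X_mem_VV h1 i (by omega))
          (Submodule.smul_mem _ _ (VV_mono (by omega) h1))) (Submodule.smul_mem _ _ (VV_of_mul_X hm))
      · exact add_mem (mul_X_mem_VV h2 i (by omega))
          (Submodule.smul_mem _ _ (VV_mono (by omega) h1))
  have hP' := hP
  rw [VV, restrictSupport_eq_span] at hP'
  induction hP' using Submodule.span_induction with
  | mem x hx =>
    obtain ⟨s, hs, rfl⟩ := hx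
    exact key s 1 m hP
  | zero => simp [dirD]
  | add x y hx hy ihx ihy =>
    rw [← restrictSupport_eq_span] at hx hy
    have e1 : tau h (x + y) - (x + y) = (tau h x - x) + (tau h y - y) := by
      rw [map_add]; ring
    have e3 : dirD h (x + y) = dirD h x + dirD h y := by
      simp [dirD, Finset.sum_add_distrib]
    have e2 : tau h (x + y) - (x + y) - dirD h (x + y)
      = (tau h x - x - dirD h x) + (tau h y - y - dirD h y) := by
      rw [e1, e3]; ring
    rw [e2, e1]
    exact ⟨add_mem (ihx hx).1 (ihy hy).1, add_mem (ihx hx).2 (ihy hy).2⟩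
  | smul c x hx ih =>
    rw [← restrictSupport_eq_span] at hx
    have e1 : tau h (c • x) - (c • x) = c • (tau h x - x) := by
      rw [map_smul, smul_sub]
    have e3 : dirD h (c • x) = c • dirD h x := by
      simp only [dirD, Derivation.map_smul, Finset.smul_sum, smul_comm c]
    have e2 : tau h (c • x) - (c • x) - dirD h (c • x)
      = c • (tau h x - x - dirD h x) := by
      rw [e1, e3, smul_sub, smul_sub, smul_sub]
    rw [e2, e1]
    exact ⟨Submodule.smul_mem _ _ (ih hx).1, Submodule.smul_mem _ _ (ih hx).2⟩

/-- Polarised iterated derivative at `0`. -/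
def Phi {n : ℕ} {S : Type*} [CommRing S] :
    (k : ℕ) → MvPolynomial (Fin n) S → (Fin k → Fin n → S) → S
  | 0, P, _ => constantCoeff P
  | k + 1, P, h => ∑ i, h 0 i * Phi k (pderiv i P) (Fin.tail h)

theorem Phi_map {n : ℕ} {S T : Type*} [CommRing S] [CommRing T] (φ : S →+* T) (k : ℕ) :
    ∀ (P : MvPolynomial (Fin n) S) (h : Fin k → Fin n → S),
    Phi k (map φ P) (fun t i => φ (h t i)) = φ (Phi k P h) := by
  induction k with
  | zero => intro P h; simp [Phi, constantCoeff_map]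
  | succ k ih =>
    intro P h
    simp only [Phi, pderiv_map, map_sum, map_mul]
    refine Finset.sum_congr rfl fun i _ => ?_
    rw [← ih]
    rfl

theorem Phi_add {n : ℕ} {S : Type*} [CommRing S] (k : ℕ) :
    ∀ (P Q : MvPolynomial (Fin n) S) (h : Fin k → Fin n → S),
    Phi k (P + Q) h = Phi k P h + Phi k Q h := by
  induction k with
  | zero => intro P Q h; simp [Phi]
  | succ k ih => intro P Q h; simp [Phi, ih, mul_add, Finset.sum_add_distrib]

theorem Phi_smul {n : ℕ} {S : Type*} [CommRing S] (k : ℕ) :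
    ∀ (c : S) (P : MvPolynomial (Fin n) S) (h : Fin k → Fin n → S),
    Phi k (c • P) h = c * Phi k P h := by
  induction k with
  | zero => intro c P h; simp [Phi]
  | succ k ih => intro c P h; simp [Phi, ih, Finset.mul_sum, mul_left_comm]

theorem Phi_sum {n : ℕ} {S : Type*} [CommRing S] (k : ℕ) {ι : Type*} (s : Finset ι)
    (P : ι → MvPolynomial (Fin n) S) (h : Fin k → Fin n → S) :
    Phi k (∑ i ∈ s, P i) h = ∑ i ∈ s, Phi k (P i) h := by
  classical
  induction s using Finset.induction_on with
  | empty => simpa using Phi_smul k (0 : S) 0 h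
  | insert a s ha ih => rw [Finset.sum_insert ha, Finset.sum_insert ha, Phi_add, ih]

theorem Phi_zero {n : ℕ} {S : Type*} [CommRing S] (k : ℕ) :
    ∀ (P : MvPolynomial (Fin n) S) (_ : P ∈ VV n S k) (h : Fin k → Fin n → S),
    Phi k P h = 0 := by
  induction k with
  | zero => intro P hP h; rw [VV_zero hP]; simp [Phi]
  | succ k ih => intro P hP h; simp [Phi, ih _ (VV_pderiv hP _)]

theorem Phi_slot {n : ℕ} {S : Type*} [CommRing S] (k : ℕ) :
    ∀ (P : MvPolynomial (Fin n) S) (h : Fin k → Fin n → S) (t : Fin k) (u v : Fin n → S),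
    Phi k P (Function.update h t (u - v)) =
      Phi k P (Function.update h t u) - Phi k P (Function.update h t v) := by
  induction k with
  | zero => intro P h t; exact t.elim0
  | succ k ih =>
    intro P h t u v
    simp only [Phi, ← Finset.sum_sub_distrib]
    refine Finset.sum_congr rfl fun i _ => ?_
    refine Fin.cases ?_ (fun t => ?_) t
    · simp [Fin.tail_update_zero, sub_mul]
    · simp [Fin.tail_update_succ, ih, mul_sub, Function.update_of_ne (Fin.succ_ne_zero t).symm]

theorem pderiv_hc {n : ℕ} {S : Type*} [CommRing S] (k : ℕ) (i : Fin n)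
    (P : MvPolynomial (Fin n) S) :
    homogeneousComponent k (pderiv i P) = pderiv i (homogeneousComponent (k + 1) P) := by
  classical
  ext s
  rw [coeff_homogeneousComponent, coeff_pderiv, coeff_pderiv, coeff_homogeneousComponent]
  simp only [map_add, Finsupp.degree_single, add_left_inj]
  split_ifs <;> simp

theorem Phi_diag {n : ℕ} {S : Type*} [CommRing S] (k : ℕ) :
    ∀ (P : MvPolynomial (Fin n) S),
    Phi k (map C P) (fun _ i => (X i : MvPolynomial (Fin n) S)) =
      k.factorial • homogeneousComponent k P := by
  induction k with
  | zero => intro P; simp [Phi, constantCoeff_map, homogeneousComponent_zero, constantCoeff_eq]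
  | succ k ih =>
    intro P
    simp only [Phi, pderiv_map]
    have : ∀ i, Phi k (map C (pderiv i P)) (Fin.tail fun _ i => (X i : MvPolynomial (Fin n) S))
      = k.factorial • pderiv i (homogeneousComponent (k + 1) P) := by
      intro i
      rw [← pderiv_hc, ← ih]; rfl
    simp only [this, mul_smul_comm, ← Finset.smul_sum]
    rw [(homogeneousComponent_isHomogeneous (k + 1) P).sum_X_mul_pderiv, ← mul_smul,
      Nat.factorial_succ, mul_comm]

theorem Phi_shift {n : ℕ} {S : Type*} [CommRing S] (k : ℕ) :
    ∀ (P : MvPolynomial (Fin n) S) (u : Fin k → Fin n → S),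
    Phi k (map C P) (fun t i => (X i + C (u t i) : MvPolynomial (Fin n) S)) -
      Phi k (map C P) (fun _ i => (X i : MvPolynomial (Fin n) S)) ∈ VV n S k ∧
    Phi k (map C P) (fun _ i => (X i : MvPolynomial (Fin n) S)) ∈ VV n S (k + 1) := by
  induction k with
  | zero => intro P u; simpa [Phi, constantCoeff_map] using VV_C _
  | succ k ih =>
    intro P u
    simp only [Phi, ← Finset.sum_sub_distrib, pderiv_map]
    constructor
    · refine sum_mem fun i _ => ?_
      obtain ⟨h1, h2⟩ := ih (pderiv i P) (Fin.tail u)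
      have e : (X i + C (u 0 i)) * Phi k (map C (pderiv i P)) (Fin.tail fun t i => (X i + C (u t i) : MvPolynomial (Fin n) S))
        - X i * Phi k (map C (pderiv i P)) (Fin.tail fun _ i => (X i : MvPolynomial (Fin n) S)) =
        X i * (Phi k (map C (pderiv i P)) (fun t i => (X i + C (Fin.tail u t i) : MvPolynomial (Fin n) S)) -
      Phi k (map C (pderiv i P)) (fun _ i => (X i : MvPolynomial (Fin n) S)))
       + C (u 0 i) * (Phi k (map C (pderiv i P)) (fun t i => (X i + C (Fin.tail u t i) : MvPolynomial (Fin n) S)) -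
      Phi k (map C (pderiv i P)) (fun _ i => (X i : MvPolynomial (Fin n) S)))
       + C (u 0 i) * Phi k (map C (pderiv i P)) (fun _ i => (X i : MvPolynomial (Fin n) S)) := by
        simp only [Fin.tail_def]; ring
      rw [e]
      refine add_mem (add_mem ?_ ?_) ?_
      · exact VV_mono (by omega) (VV_mul (VV_X i) h1)
      · exact VV_mono (by omega) (VV_mul (VV_C _) h1)
      · exact VV_mono (by omega) (VV_mul (VV_C _) h2)
    · refine sum_mem fun i _ => ?_
      obtain ⟨h1, h2⟩ := ih (pderiv i P) (Fin.tail u)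
      exact VV_mono (by omega) (VV_mul (VV_X i) h2)

theorem Phi_bound {n : ℕ} (k : ℕ) :
    ∀ (P : MvPolynomial (Fin n) ℤ), ∃ c : ℕ, ∀ (B : ℕ) (h : Fin k → Fin n → ℤ),
      (∀ t i, |h t i| ≤ B) → |Phi k P h| ≤ c * (B : ℤ) ^ k := by
  induction k with
  | zero => intro P; exact ⟨(constantCoeff P).natAbs, fun B h _ => by simp [Phi]⟩
  | succ k ih =>
    intro P
    choose c hc using fun i => ih (pderiv i P)
    refine ⟨∑ i, c i, fun B h hh => ?_⟩
    simp only [Phi]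
    refine (Finset.abs_sum_le_sum_abs _ _).trans ?_
    push_cast
    rw [Finset.sum_mul]
    refine Finset.sum_le_sum fun i _ => ?_
    rw [abs_mul]
    calc |h 0 i| * |Phi k (pderiv i P) (Fin.tail h)| ≤ B * (c i * (B : ℤ) ^ k) := by
          gcongr
          · exact hh 0 i
          · exact hc i B _ fun t j => hh _ _
      _ = _ := by ring

/-- iterated finite differences -/
def Dk {G A : Type*} [Add G] [Sub A] : (k : ℕ) → (Fin k → G) → (G → A) → G → A
  | 0, _, F => F
  | k + 1, h, F => Dk k (Fin.tail h) (fun x => F (x + h 0) - F x)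

theorem Dk_add {G A : Type*} [Add G] [AddCommGroup A] (k : ℕ) :
    ∀ (h : Fin k → G) (F F' : G → A) (x : G),
    Dk k h (fun x => F x + F' x) x = Dk k h F x + Dk k h F' x := by
  induction k with
  | zero => intros; rfl
  | succ k ih =>
    intro h F F' x
    simp only [Dk]
    rw [← ih]
    congr 1; funext x; abel

theorem eval_affine {n : ℕ} {S : Type*} [CommRing S] (P : MvPolynomial (Fin n) S)
    (hP : P ∈ VV n S 2) (x : Fin n → S) :
    eval x P = constantCoeff P + ∑ j, x j * constantCoeff (pderiv j P) := by
  have h := (tau_VV x 2 P hP).2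
  have h0 := VV_zero h
  have h1 : constantCoeff (tau x P) = eval x P := by
    rw [← eval_zero, tau, ← coe_aeval_eq_eval, ← coe_aeval_eq_eval]
    change aeval (0 : Fin n → S) _ = _
    rw [← AlgHom.comp_apply, comp_aeval]
    simp
  have h2 := congrArg constantCoeff h0
  rw [map_sub, map_sub, h1] at h2
  simp only [dirD, map_sum, smul_eq_C_mul, map_mul, constantCoeff_C, map_zero] at h2
  linear_combination h2

theorem eval_tau {n : ℕ} {S : Type*} [CommRing S] (P : MvPolynomial (Fin n) S) (h x : Fin n → S) :
    eval x (tau h P) = eval (x + h) P := by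
  rw [tau, ← coe_aeval_eq_eval, ← coe_aeval_eq_eval]
  change aeval x _ = _
  rw [← AlgHom.comp_apply, comp_aeval]
  simp
  rfl

theorem pderiv_comm' {n : ℕ} {S : Type*} [CommRing S] (i j : Fin n) (P : MvPolynomial (Fin n) S) :
    pderiv i (pderiv j P) = pderiv j (pderiv i P) := by
  classical
  ext s
  simp only [coeff_pderiv, Finsupp.add_apply, Finsupp.single_apply]
  rw [add_right_comm]
  by_cases h : i = j
  · subst h; rfl
  · simp [h, Ne.symm h]; ring

theorem Dk_poly {n : ℕ} {S : Type*} [CommRing S] (k : ℕ) :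
    ∀ (P : MvPolynomial (Fin n) S) (_ : P ∈ VV n S (k + 2)) (h : Fin k → Fin n → S),
    ∃ c : S, ∀ x, Dk k h (fun x => eval x P) x = c + ∑ j, x j * Phi k (pderiv j P) h := by
  induction k with
  | zero => intro P hP h; exact ⟨_, fun x => eval_affine P hP x⟩
  | succ k ih =>
    intro P hP h
    set E := tau (h 0) P - P - dirD (h 0) P with hE
    have hEm : E ∈ VV n S (k + 1) := (tau_VV (h 0) _ P hP).2
    have hD : dirD (h 0) P ∈ VV n S (k + 2) :=
      sum_mem fun i _ => Submodule.smul_mem _ _ (VV_pderiv hP i)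
    obtain ⟨c1, h1⟩ := ih _ hD (Fin.tail h)
    obtain ⟨c2, h2⟩ := ih _ (VV_mono (by omega) hEm) (Fin.tail h)
    refine ⟨c1 + c2, fun x => ?_⟩
    have e : (fun x => eval (x + h 0) P - eval x P) =
        fun x => eval x (dirD (h 0) P) + eval x E := by
      funext x
      rw [hE, map_sub, map_sub, eval_tau]; ring
    simp only [Dk]
    rw [e, Dk_add, h1, h2]
    have z : ∀ j, Phi k (pderiv j E) (Fin.tail h) = 0 := fun j => Phi_zero k _ (VV_pderiv hEm j) _
    simp only [z, mul_zero, Finset.sum_const_zero, add_zero]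
    have w : ∀ j, Phi k (pderiv j (dirD (h 0) P)) (Fin.tail h) =
        Phi (k + 1) (pderiv j P) h := by
      intro j
      simp only [Phi, dirD, map_sum, Phi_sum, Derivation.map_smul, Phi_smul, pderiv_comm' j]
    simp only [w]
    ring

end LD

namespace LD

theorem sum_cons {G A : Type*} [Fintype G] [AddCommMonoid A] (k : ℕ) (φ : (Fin (k + 1) → G) → A) :
    ∑ h, φ h = ∑ g : G, ∑ t : Fin k → G, φ (Fin.cons g t) := by
  rw [← Fintype.sum_prod_type' (fun g t => φ (Fin.cons g t))]
  exact (Fintype.sum_equiv (Fin.consEquiv fun _ => G) _ _ fun x => rfl).symm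

/-- multiplicative differences -/
def Mk {G : Type*} [Add G] : (k : ℕ) → (Fin k → G) → (G → ℂ) → G → ℂ
  | 0, _, F => F
  | k + 1, h, F => Mk k (Fin.tail h) (fun x => F (x + h 0) * (starRingEnd ℂ) (F x))

theorem Mk_char {G A : Type*} [Add G] [AddCommGroup A] [Finite A] (χ : AddChar A ℂ) (k : ℕ) :
    ∀ (h : Fin k → G) (g : G → A), Mk k h (fun x => χ (g x)) = fun x => χ (Dk k h g x) := by
  induction k with
  | zero => intros; rfl
  | succ k ih =>
    intro h g
    simp only [Mk, Dk]
    rw [← ih]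
    congr 1
    funext x
    rw [← AddChar.map_neg_eq_conj, ← AddChar.map_add_eq_mul, sub_eq_add_neg]

theorem weyl1 {G : Type*} [AddCommGroup G] [Fintype G] (F : G → ℂ) :
    ‖∑ x, F x‖ ^ 2 ≤ ∑ h, ‖∑ x, F (x + h) * (starRingEnd ℂ) (F x)‖ := by
  refine le_trans (le_of_eq ?_) (norm_sum_le _ _)
  have : ∑ h, ∑ x, F (x + h) * (starRingEnd ℂ) (F x) = (∑ x, F x) * (starRingEnd ℂ) (∑ x, F x) := by
    rw [Finset.sum_comm, map_sum, Finset.mul_sum]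
    refine Finset.sum_congr rfl fun x _ => ?_
    rw [← Finset.sum_mul]
    congr 1
    exact Fintype.sum_equiv (Equiv.addLeft x) _ _ fun _ => rfl
  rw [this, norm_mul, RCLike.norm_conj, sq]

theorem weyl {G : Type*} [AddCommGroup G] [Fintype G] (k : ℕ) :
    ∀ F : G → ℂ, (Fintype.card G : ℝ) ^ (k + 1) * ‖∑ x, F x‖ ^ 2 ^ k ≤
      (Fintype.card G : ℝ) ^ 2 ^ k * ∑ h : Fin k → G, ‖∑ x, Mk k h F x‖ := by
  induction k with
  | zero => intro F; simp [Mk]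
  | succ k ih =>
    intro F
    set c : ℝ := (Fintype.card G : ℝ) with hc
    have hc0 : 0 < c := by
      rw [hc]; exact_mod_cast Fintype.card_pos
    set t : G → ℝ := fun h => ‖∑ x, F (x + h) * (starRingEnd ℂ) (F x)‖ with ht
    have h1 : ‖∑ x, F x‖ ^ 2 ^ (k + 1) ≤ (∑ h, t h) ^ 2 ^ k := by
      rw [pow_succ', pow_mul]
      exact pow_le_pow_left₀ (by positivity) (weyl1 F) _
    have h2 : c * (∑ h, t h) ^ 2 ^ k ≤ c ^ 2 ^ k * ∑ h, t h ^ 2 ^ k := by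
      obtain ⟨m, hm⟩ : ∃ m, 2 ^ k = m + 1 := ⟨2 ^ k - 1, by have := Nat.one_le_two_pow (n := k); omega⟩
      have := pow_sum_div_card_le_sum_pow (s := Finset.univ) (f := t) (fun _ _ => norm_nonneg _) m
      rw [Finset.card_univ, ← hc, div_le_iff₀ (by positivity)] at this
      rw [hm]
      calc c * (∑ h, t h) ^ (m + 1) ≤ c * ((∑ h, t h ^ (m + 1)) * c ^ m) := by gcongr
        _ = _ := by ring
    calc c ^ (k + 1 + 1) * ‖∑ x, F x‖ ^ 2 ^ (k + 1) ≤ c ^ (k + 1 + 1) * (∑ h, t h) ^ 2 ^ k := by gcongr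
      _ = c ^ (k + 1) * (c * (∑ h, t h) ^ 2 ^ k) := by ring
      _ ≤ c ^ (k + 1) * (c ^ 2 ^ k * ∑ h, t h ^ 2 ^ k) := by gcongr
      _ = c ^ 2 ^ k * ∑ h, c ^ (k + 1) * t h ^ 2 ^ k := by rw [Finset.mul_sum, Finset.mul_sum, Finset.mul_sum]; refine Finset.sum_congr rfl fun _ _ => by ring
      _ ≤ c ^ 2 ^ k * ∑ h, c ^ 2 ^ k * ∑ h' : Fin k → G,
            ‖∑ x, Mk k h' (fun x => F (x + h) * (starRingEnd ℂ) (F x)) x‖ := by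
          refine mul_le_mul_of_nonneg_left (Finset.sum_le_sum fun h _ => ?_) (by positivity)
          exact ih _
      _ = _ := by
          rw [sum_cons, ← Finset.mul_sum, ← mul_assoc, pow_succ 2 k, mul_two, pow_add]
          rfl

theorem sum_lin {q n : ℕ} [NeZero q] (c : ZMod q) (φ : Fin n → ZMod q) :
    ‖∑ x : Fin n → ZMod q, ZMod.stdAddChar (c + ∑ j, x j * φ j)‖ ≤
      if (∀ j, φ j = 0) then (Fintype.card (Fin n → ZMod q) : ℝ) else 0 := by
  classical
  split_ifs with h
  · refine (norm_sum_le _ _).trans ?_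
    simp
  · push Not at h
    obtain ⟨j, hj⟩ := h
    let ψ : AddChar (Fin n → ZMod q) ℂ :=
      { toFun := fun x => ZMod.stdAddChar (∑ j, x j * φ j)
        map_zero_eq_one' := by simp
        map_add_eq_mul' := fun x y => by
          rw [← AddChar.map_add_eq_mul, ← Finset.sum_add_distrib]
          simp [add_mul] }
    have hψ : ψ ≠ 0 := by
      intro h0
      have h1 : ψ (Pi.single j 1) = 1 := by rw [h0]; simp
      change ZMod.stdAddChar (∑ i, (Pi.single j 1 : Fin n → ZMod q) i * φ i) = 1 at h1
      rw [Finset.sum_eq_single j (by intro i _ hi; simp [hi]) (by simp), Pi.single_eq_same, one_mul,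
        ← (ZMod.stdAddChar (N := q)).map_zero_eq_one, ZMod.injective_stdAddChar.eq_iff] at h1
      exact hj h1
    have h2 : ∑ x, ψ x = 0 := AddChar.sum_eq_zero_iff_ne_zero.2 hψ
    have h3 : ∑ x : Fin n → ZMod q, ZMod.stdAddChar (c + ∑ j, x j * φ j) = ZMod.stdAddChar c * ∑ x, ψ x := by
      rw [Finset.mul_sum]
      refine Finset.sum_congr rfl fun x _ => ?_
      rw [AddChar.map_add_eq_mul]; rfl
    rw [h3, h2]; simp

open Classical in
theorem weyl_poly {q n : ℕ} [NeZero q] (k : ℕ) (P : MvPolynomial (Fin n) (ZMod q))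
    (hP : P ∈ VV n (ZMod q) (k + 2)) :
    ((q : ℝ) ^ n) ^ k * ‖∑ x, ZMod.stdAddChar (eval x P)‖ ^ 2 ^ k ≤
      ((q : ℝ) ^ n) ^ 2 ^ k * (Finset.univ.filter fun h : Fin k → Fin n → ZMod q =>
        ∀ j, Phi k (pderiv j P) h = 0).card := by
  have hw := weyl k (fun x => ZMod.stdAddChar (eval x P))
  have hcard : (Fintype.card (Fin n → ZMod q) : ℝ) = (q : ℝ) ^ n := by
    simp [ZMod.card]
  have hq : (0 : ℝ) < (q : ℝ) ^ n := by
    have := NeZero.pos q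
    positivity
  have h2 : ∑ h : Fin k → Fin n → ZMod q, ‖∑ x, Mk k h (fun x => ZMod.stdAddChar (eval x P)) x‖ ≤
      ∑ h : Fin k → Fin n → ZMod q, if (∀ j, Phi k (pderiv j P) h = 0) then (q : ℝ) ^ n else 0 := by
    refine Finset.sum_le_sum fun h _ => ?_
    obtain ⟨c, hc⟩ := Dk_poly k P hP h
    rw [Mk_char]
    simp only [hc]
    rw [← hcard]
    exact sum_lin _ _
  rw [hcard] at hw
  rw [← Finset.sum_filter, Finset.sum_const, nsmul_eq_mul] at h2
  have h3 := hw.trans (mul_le_mul_of_nonneg_left h2 (by positivity))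
  rw [pow_succ] at h3
  refine le_of_mul_le_mul_left ?_ hq
  linarith

open Classical in
theorem shrink {G : Type*} [AddCommGroup G] [Fintype G] (Box : G → Prop) (M : ℕ)
    (hM : ∀ E : G → Prop, (∀ u v, E u → E v → E (u - v)) →
      (Finset.univ.filter E).card ≤ M * (Finset.univ.filter fun g => E g ∧ Box g).card) (k : ℕ) :
    ∀ E : (Fin k → G) → Prop, (∀ h t u v, E (Function.update h t u) → E (Function.update h t v) →
      E (Function.update h t (u - v))) →
      (Finset.univ.filter E).card ≤
        M ^ k * (Finset.univ.filter fun h => E h ∧ ∀ t, Box (h t)).card := by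
  induction k with
  | zero => intro E _; simp
  | succ k ih =>
    intro E hE
    have c1 : (Finset.univ.filter E).card =
        ∑ g : G, (Finset.univ.filter fun t : Fin k → G => E (Fin.cons g t)).card := by
      simp only [Finset.card_filter, sum_cons]
    have c2 : (Finset.univ.filter fun h => E h ∧ ∀ t, Box (h t)).card =
        ∑ t : Fin k → G, ∑ g : G, if (E (Fin.cons g t) ∧ Box g) ∧ ∀ i, Box (t i) then 1 else 0 := by
      rw [Finset.card_filter, sum_cons, Finset.sum_comm]
      refine Finset.sum_congr rfl fun t _ => Finset.sum_congr rfl fun g _ => ?_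
      simp [Fin.forall_fin_succ, and_assoc]
    rw [c1, c2]
    calc _ ≤ ∑ g : G, M ^ k * (Finset.univ.filter fun t : Fin k → G => E (Fin.cons g t) ∧ ∀ i, Box (t i)).card := by
          refine Finset.sum_le_sum fun g _ => ih _ ?_
          intro h t u v hu hv
          have := hE (Fin.cons g h) t.succ u v
          simp only [← Fin.cons_update] at this
          exact this hu hv
      _ = M ^ k * ∑ t : Fin k → G, ∑ g : G, if (E (Fin.cons g t) ∧ ∀ i, Box (t i)) then 1 else 0 := by
          rw [← Finset.mul_sum, Finset.sum_comm]
          simp only [Finset.card_filter]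
      _ ≤ M ^ k * ∑ t : Fin k → G, M * ∑ g : G, if (E (Fin.cons g t) ∧ Box g) ∧ ∀ i, Box (t i) then 1 else 0 := by
          gcongr with t _
          by_cases hb : ∀ i, Box (t i)
          · have h9 := hM (fun g => E (Fin.cons g t)) (by
              intro u v hu hv
              have := hE (Fin.cons u t) 0 u v
              simp only [Fin.update_cons_zero] at this
              exact this hu hv)
            rw [Finset.card_filter, Finset.card_filter] at h9
            simp only [hb, implies_true, and_true]
            exact h9
          · simp [hb]
      _ = _ := by rw [← Finset.mul_sum, pow_succ]; ring

/-- residues having small representatives -/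
def SBox (n q B : ℕ) (g : Fin n → ZMod q) : Prop :=
  ∃ z : Fin n → ℤ, (∀ i, |z i| < B) ∧ ∀ i, g i = (z i : ZMod q)

open Classical in
theorem shrink_box (n q B M : ℕ) [NeZero q] (hB : 0 < B) (hq : q = B * M)
    (E : (Fin n → ZMod q) → Prop) (hE : ∀ u v, E u → E v → E (u - v)) :
    (Finset.univ.filter E).card ≤
      M ^ n * (Finset.univ.filter fun g => E g ∧ SBox n q B g).card := by
  have hlt : ∀ (g : Fin n → ZMod q) i, (g i).val / B < M := by
    intro g i
    rw [Nat.div_lt_iff_lt_mul hB, mul_comm, ← hq]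
    exact ZMod.val_lt _
  let blk : (Fin n → ZMod q) → (Fin n → Fin M) := fun g i => ⟨(g i).val / B, hlt g i⟩
  have := Finset.card_le_mul_card_image_of_maps_to (f := blk) (s := Finset.univ.filter E)
    (t := Finset.univ) (fun _ _ => Finset.mem_univ _)
    (Finset.univ.filter fun g => E g ∧ SBox n q B g).card ?_
  · refine this.trans ?_
    simp [mul_comm]
  intro b _
  rcases Finset.eq_empty_or_nonempty ({a ∈ Finset.univ.filter E | blk a = b}) with h | ⟨g0, hg0⟩
  · rw [h]; simp
  · refine Finset.card_le_card_of_injOn (fun g => g - g0) ?_ ?_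
    · intro g hg
      simp only [Finset.coe_filter, Finset.mem_filter, Finset.mem_univ, true_and, Set.mem_ofPred_eq] at hg hg0 ⊢
      refine ⟨hE _ _ hg.1 hg0.1, fun i => ((g i).val : ℤ) - ((g0 i).val : ℤ), fun i => ?_, fun i => ?_⟩
      · have h1 : (g i).val / B = (g0 i).val / B := by
          have := congrFun (hg.2.trans hg0.2.symm) i
          simpa [blk] using this
        have h2 := Nat.div_add_mod (g i).val B
        have h3 := Nat.div_add_mod (g0 i).val B
        have h4 := Nat.mod_lt (g i).val hB
        have h5 := Nat.mod_lt (g0 i).val hB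
        rw [h1] at h2
        rw [abs_lt]
        beta_reduce
        constructor <;> omega
      · simp
    · intro a _ b _ h
      simpa using h

end LD

namespace LD

theorem sum_mem_VV_of_monomials {n : ℕ} {k : Type*} [Field k] {p : MvPolynomial (Fin n) k → Prop}
    (hadd : ∀ P Q, p P → p Q → p (P + Q)) (hsmul : ∀ (c : k) P, p P → p (c • P)) (h0 : p 0)
    {m : ℕ} (hm : ∀ s : Fin n →₀ ℕ, s.degree < m → p (monomial s 1))
    (P : MvPolynomial (Fin n) k) (hP : P ∈ VV n k m) : p P := by
  classical
  rw [P.as_sum]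
  have : ∀ T : Finset (Fin n →₀ ℕ), T ⊆ P.support → p (∑ s ∈ T, monomial s (coeff s P)) := by
    intro T
    induction T using Finset.induction_on with
    | empty => intro _; simpa using h0
    | insert a s ha ih =>
      intro hT
      rw [Finset.sum_insert ha]
      refine hadd _ _ ?_ (ih (fun x hx => hT (Finset.mem_insert_of_mem hx)))
      have h1 : monomial a (coeff a P) = coeff a P • (monomial a 1 : MvPolynomial (Fin n) k) := by
        simp [smul_monomial]
      rw [h1]
      apply hsmul
      apply hm
      exact mem_VV.1 hP a (mem_support_iff.1 (hT (Finset.mem_insert_self _ _)))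
  exact this _ (Finset.Subset.refl _)

theorem reduce_mod {n : ℕ} {k : Type*} [Field k] {τ : Type*} [Fintype τ] (N : ℕ) (hN : 1 ≤ N)
    (e : τ → ℕ) (he : ∀ t, e t ≤ N) (G Gt : τ → MvPolynomial (Fin n) k)
    (hG : ∀ t, Gt t - G t ∈ VV n k (e t))
    (hgood : ∀ s : Fin n →₀ ℕ, s.degree = N → ∃ A : τ → MvPolynomial (Fin n) k,
      (∀ t, A t ∈ VV n k (N - e t + 1)) ∧ monomial s 1 = ∑ t, A t * G t)
    (Z : Set (Fin n → k)) (hZ : ∀ z ∈ Z, ∀ t, eval z (Gt t) = 0) (m : ℕ) :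
    ∀ P ∈ VV n k (N + m), ∃ Q ∈ VV n k N, ∀ z ∈ Z, eval z P = eval z Q := by
  induction m with
  | zero => intro P hP; exact ⟨P, hP, fun _ _ => rfl⟩
  | succ m ih =>
    apply sum_mem_VV_of_monomials (p := fun P => ∃ Q ∈ VV n k N, ∀ z ∈ Z, eval z P = eval z Q)
    · rintro P Q ⟨P', hP, h1⟩ ⟨Q', hQ, h2⟩
      exact ⟨P' + Q', add_mem hP hQ, fun z hz => by simp [h1 z hz, h2 z hz]⟩
    · rintro c P ⟨P', hP, h1⟩
      exact ⟨c • P', Submodule.smul_mem _ _ hP, fun z hz => by simp [h1 z hz]⟩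
    · exact ⟨0, zero_mem _, fun _ _ => rfl⟩
    · intro s hs
      by_cases hs' : s.degree < N + m
      · apply ih
        rw [mem_VV]
        intro s' h'
        classical
        rw [coeff_monomial] at h'
        have : s = s' := by by_contra h; simp [h] at h'
        subst this
        omega
      · have hdeg : s.degree = N + m := by omega
        obtain ⟨u, hu, hud⟩ := Finsupp.exists_le_degree_eq s N (by omega)
        obtain ⟨A, hA, hAe⟩ := hgood u hud
        have hsu : s = (s - u) + u := (tsub_add_cancel_of_le hu).symm
        have hdsu : (s - u).degree = m := by
          have := congrArg Finsupp.degree hsu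
          rw [map_add] at this
          omega
        have hmon : (monomial s 1 : MvPolynomial (Fin n) k) =
            monomial (s - u) 1 * ∑ t, A t * G t := by
          rw [← hAe, monomial_mul, ← hsu, one_mul]
        have hms : (monomial (s - u) 1 : MvPolynomial (Fin n) k) ∈ VV n k (m + 1) := by
          rw [mem_VV]
          intro s' h'
          classical
          rw [coeff_monomial] at h'
          have : s - u = s' := by by_contra h; simp [h] at h'
          subst this
          omega
        have hlow : monomial (s - u) 1 * ∑ t, A t * (G t - Gt t) ∈ VV n k (N + m) := by
          rw [add_comm]
          apply VV_mul hms
          apply Submodule.sum_mem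
          intro t _
          have := VV_mul (hA t) (by rw [← neg_sub]; exact neg_mem (hG t) : G t - Gt t ∈ VV n k (e t))
          exact VV_mono (by have := he t; omega) this
        obtain ⟨Q, hQ, hQe⟩ := ih _ hlow
        refine ⟨Q, hQ, fun z hz => ?_⟩
        rw [← hQe z hz, hmon]
        simp only [map_mul, map_sum, map_sub, hZ z hz, sub_zero]

theorem VV_finite {n : ℕ} {k : Type*} [Field k] (N : ℕ) : Module.Finite k (VV n k N) := by
  have hf : Set.Finite {s : Fin n →₀ ℕ | s.degree < N} :=
    (Finsupp.finite_of_degree_le N).subset (fun s hs => by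
      simp only [Set.mem_ofPred_eq] at hs ⊢; omega)
  have : Finite {s : Fin n →₀ ℕ | s.degree < N} := hf
  exact Module.Finite.of_basis (basisRestrictSupport k {s : Fin n →₀ ℕ | s.degree < N})

theorem VV_finrank {n : ℕ} {k : Type*} [Field k] (N : ℕ) :
    Module.finrank k (VV n k N) = Nat.card {s : Fin n →₀ ℕ | s.degree < N} :=
  Module.finrank_eq_nat_card_basis (basisRestrictSupport k {s : Fin n →₀ ℕ | s.degree < N})

theorem fibre_count {n : ℕ} {k : Type*} [Field k] {τ : Type*} [Fintype τ] (N : ℕ) (hN : 1 ≤ N)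
    (e : τ → ℕ) (he : ∀ t, e t ≤ N) (G Gt : τ → MvPolynomial (Fin n) k)
    (hG : ∀ t, Gt t - G t ∈ VV n k (e t))
    (hgood : ∀ s : Fin n →₀ ℕ, s.degree = N → ∃ A : τ → MvPolynomial (Fin n) k,
      (∀ t, A t ∈ VV n k (N - e t + 1)) ∧ monomial s 1 = ∑ t, A t * G t)
    (Z : Finset (Fin n → k)) (hZ : ∀ z ∈ Z, ∀ t, eval z (Gt t) = 0) :
    Z.card ≤ Nat.card {s : Fin n →₀ ℕ | s.degree < N} := by
  classical
  have := VV_finite (n := n) (k := k) N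
  rw [← VV_finrank (k := k)]
  let ev : VV n k N →ₗ[k] (Z → k) :=
    { toFun := fun P z => eval z.1 P.1
      map_add' := by intro P Q; ext z; simp
      map_smul' := by intro c P; ext z; simp }
  have hsurj : Function.Surjective ev := by
    intro g
    -- interpolation
    have hsep : ∀ z w : Fin n → k, z ≠ w → ∃ L : MvPolynomial (Fin n) k,
        eval z L = 1 ∧ eval w L = 0 := by
      intro z w h
      obtain ⟨i, hi⟩ := Function.ne_iff.1 h
      refine ⟨C (z i - w i)⁻¹ * (X i - C (w i)), ?_, ?_⟩
      · simp [inv_mul_cancel₀ (sub_ne_zero.2 hi)]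
      · simp
    choose! L hL using hsep
    let P : MvPolynomial (Fin n) k := ∑ z : Z, C (g z) * ∏ w ∈ Z.erase z.1, L z.1 w
    have hP : ∀ z : Z, eval z.1 P = g z := by
      intro z
      simp only [P, map_sum, map_mul, map_prod, eval_C]
      rw [Finset.sum_eq_single z]
      · rw [Finset.prod_eq_one]
        · simp
        · intro w hw
          exact (hL z.1 w (Finset.ne_of_mem_erase hw).symm).1
      · intro y _ hy
        have hne : z.1 ∈ Z.erase y.1 :=
          Finset.mem_erase.2 ⟨fun h => hy (Subtype.ext h.symm), z.2⟩
        rw [Finset.prod_eq_zero hne, mul_zero]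
        exact (hL y.1 z.1 (fun h => hy (Subtype.ext h))).2
      · simp
    obtain ⟨Q, hQ, hQe⟩ := reduce_mod N hN e he G Gt hG hgood (Z : Set (Fin n → k)) hZ
      (P.totalDegree + 1) P (VV_mono (by omega) (VV_of_totalDegree le_rfl))
    refine ⟨⟨Q, hQ⟩, ?_⟩
    ext z
    change eval z.1 Q = g z
    rw [← hQe z.1 z.2, hP]
  have := LinearMap.finrank_le_finrank_of_surjective hsurj
  simpa using this

end LD

namespace LD

theorem noeth_cover {k : Type*} [Field k] {R : ℕ} {ι : Type*} (Gd : ι → (Fin R → k) → Prop)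
    (Bs : Set (Fin R → k))
    (h : ∀ b ∈ Bs, ∃ i, ∃ δ : MvPolynomial (Fin R) k, eval b δ ≠ 0 ∧
      ∀ b', eval b' δ ≠ 0 → Gd i b') :
    ∃ F : Finset ι, ∀ b ∈ Bs, ∃ i ∈ F, Gd i b := by
  classical
  let D : Set (MvPolynomial (Fin R) k) := {δ | ∃ i, ∀ b', eval b' δ ≠ 0 → Gd i b'}
  have hfg : (Ideal.span D).FG := IsNoetherian.noetherian _
  obtain ⟨T, hTD, hT⟩ := Submodule.fg_span_iff_fg_span_finset_subset D |>.1 hfg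
  have hTi : ∀ δ : MvPolynomial (Fin R) k, ∃ i : Option ι, δ ∈ T →
      ∃ i', i = some i' ∧ ∀ b', eval b' δ ≠ 0 → Gd i' b' := by
    intro δ
    by_cases hδ : δ ∈ T
    · obtain ⟨i, hi⟩ := hTD hδ
      exact ⟨some i, fun _ => ⟨i, rfl, hi⟩⟩
    · exact ⟨none, fun h => absurd h hδ⟩
  choose c hc using hTi
  refine ⟨(T.image c).eraseNone, ?_⟩
  intro b hb
  obtain ⟨i, δ, hne, hδ⟩ := h b hb
  have hmem : δ ∈ Submodule.span (MvPolynomial (Fin R) k) (T : Set (MvPolynomial (Fin R) k)) := by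
    rw [← hT]
    exact Submodule.subset_span ⟨i, hδ⟩
  have : ∃ t ∈ T, eval b t ≠ 0 := by
    by_contra hcon
    push Not at hcon
    apply hne
    have hle : Ideal.span (T : Set (MvPolynomial (Fin R) k)) ≤ RingHom.ker (eval b) := by
      rw [Ideal.span_le]
      intro t ht
      exact hcon t ht
    exact hle hmem
  obtain ⟨t, ht, htne⟩ := this
  obtain ⟨i', hi', hg⟩ := hc t ht
  refine ⟨i', ?_, hg b htne⟩
  rw [Finset.mem_eraseNone, ← hi']
  exact Finset.mem_image_of_mem _ ht

/-- every monomial of degree `N` is a combination of the `G t` -/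
def Good {n : ℕ} {k : Type*} [Field k] {τ : Type*} [Fintype τ] (N : ℕ) (e : τ → ℕ)
    (G : τ → MvPolynomial (Fin n) k) : Prop :=
  ∀ s : Fin n →₀ ℕ, s.degree = N → ∃ A : τ → MvPolynomial (Fin n) k,
      (∀ t, (A t).IsHomogeneous (N - e t)) ∧ monomial s 1 = ∑ t, A t * G t

theorem homog_VV {n : ℕ} {S : Type*} [CommRing S] {m : ℕ} {P : MvPolynomial (Fin n) S}
    (h : P.IsHomogeneous m) : P ∈ VV n S (m + 1) := by
  exact VV_of_totalDegree (h.totalDegree_le)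

theorem good_open {n R : ℕ} {k : Type*} [Field k] {τ : Type*} [Fintype τ] (N : ℕ) (e : τ → ℕ)
    (he : ∀ t, e t ≤ N) (G : τ → MvPolynomial (Fin n) (MvPolynomial (Fin R) k))
    (hG : ∀ t, (G t).IsHomogeneous (e t)) (b : Fin R → k)
    (hb : Good N e (fun t => map (eval b) (G t))) :
    ∃ δ : MvPolynomial (Fin R) k, eval b δ ≠ 0 ∧
      ∀ b', eval b' δ ≠ 0 → Good N e (fun t => map (eval b') (G t)) := by
  classical
  have hfin : Set.Finite {s : Fin n →₀ ℕ | s.degree = N} :=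
    (Finsupp.finite_of_degree_le N).subset (fun s hs => by
      simp only [Set.mem_ofPred_eq] at hs ⊢; omega)
  have : Fintype {s : Fin n →₀ ℕ // s.degree = N} := hfin.fintype
  have hb' : ∀ s : {s : Fin n →₀ ℕ // s.degree = N}, ∃ A : τ → MvPolynomial (Fin n) k,
      (∀ t, (A t).IsHomogeneous (N - e t)) ∧
      monomial s.1 1 = ∑ t, A t * map (eval b) (G t) := fun s => hb s.1 s.2
  choose A hA hAe using hb'
  let P : {s : Fin n →₀ ℕ // s.degree = N} → MvPolynomial (Fin n) (MvPolynomial (Fin R) k) :=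
    fun s => ∑ t, map C (A s t) * G t
  have hPev : ∀ s b', map (eval b') (P s) = ∑ t, A s t * map (eval b') (G t) := by
    intro s b'
    simp only [P, map_sum, map_mul, MvPolynomial.map_map]
    have : (eval b').comp (C : k →+* MvPolynomial (Fin R) k) = RingHom.id k := by
      ext x; simp
    simp only [this, MvPolynomial.map_id, RingHom.id_apply]
  have hPh : ∀ s, (P s).IsHomogeneous N := by
    intro s
    apply IsHomogeneous.sum
    intro t _
    have := ((hA s t).map C (S := MvPolynomial (Fin R) k)).mul (hG t)
    rwa [Nat.sub_add_cancel (he t)] at this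
  let M : Matrix {s : Fin n →₀ ℕ // s.degree = N} {s : Fin n →₀ ℕ // s.degree = N}
    (MvPolynomial (Fin R) k) := Matrix.of fun s s' => coeff s'.1 (P s)
  refine ⟨M.det, ?_, ?_⟩
  · rw [RingHom.map_det]
    have : (eval b).mapMatrix M = 1 := by
      ext s s'
      simp only [RingHom.mapMatrix_apply, Matrix.map_apply, M, Matrix.of_apply]
      rw [← coeff_map, hPev, ← hAe, coeff_monomial, Matrix.one_apply]
      simp [Subtype.ext_iff]
    rw [this]
    simp
  · intro b' hne s hs
    rw [RingHom.map_det] at hne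
    set W := (eval b').mapMatrix M with hW
    have hinv : W⁻¹ * W = 1 := Matrix.nonsing_inv_mul _ (isUnit_iff_ne_zero.2 hne)
    refine ⟨fun t => ∑ s', C (W⁻¹ ⟨s, hs⟩ s') * A s' t, ?_, ?_⟩
    · intro t
      apply IsHomogeneous.sum
      intro s' _
      have := (isHomogeneous_C (Fin n) (W⁻¹ ⟨s, hs⟩ s')).mul (hA s' t)
      rwa [zero_add] at this
    · have h1 : ∑ t, (∑ s', C (W⁻¹ ⟨s, hs⟩ s') * A s' t) * map (eval b') (G t) =
          ∑ s', C (W⁻¹ ⟨s, hs⟩ s') * map (eval b') (P s') := by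
        simp only [hPev, Finset.sum_mul, Finset.mul_sum]
        rw [Finset.sum_comm]
        simp only [mul_assoc]
      rw [h1]
      ext s''
      rw [coeff_sum]
      simp only [coeff_C_mul]
      by_cases h2 : s''.degree = N
      · have := congrFun (congrFun hinv ⟨s, hs⟩) ⟨s'', h2⟩
        rw [Matrix.mul_apply] at this
        rw [coeff_monomial]
        have h3 : ∀ x, coeff s'' (map (eval b') (P x)) = W x ⟨s'', h2⟩ := by
          intro x
          rw [MvPolynomial.coeff_map]
          simp [hW, M]
        simp only [h3, this, Matrix.one_apply, Subtype.mk.injEq]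
      · rw [coeff_monomial, if_neg (by rintro rfl; exact h2 hs)]
        symm
        apply Finset.sum_eq_zero
        intro x _
        rw [coeff_map, (hPh x).coeff_eq_zero h2]
        simp

end LD

namespace LD

/-- chains of primes above `I` have length at most `m` -/
def DimLe {A : Type*} [CommRing A] (I : Ideal A) (m : ℕ) : Prop :=
  ∀ l : LTSeries (PrimeSpectrum A), I ≤ l.head.asIdeal → l.length ≤ m

theorem dimLe_of_krull {A : Type*} [CommRing A] (I : Ideal A) (m : ℕ)
    (h : ringKrullDim (A ⧸ I) ≤ ((m : ℕ∞) : WithBot ℕ∞)) : DimLe I m := by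
  intro l hl
  rw [ringKrullDim_quotient] at h
  let l' : LTSeries (PrimeSpectrum.zeroLocus (R := A) I) :=
    LTSeries.mk l.length (fun i => ⟨l i, by
      have h1 : l.head ≤ l i := LTSeries.head_le l i
      exact fun x hx => h1 (hl hx)⟩) (fun i j hij => l.strictMono hij)
  have h2 := (Order.LTSeries.length_le_krullDim l').trans h
  exact_mod_cast h2

theorem eq_of_X_mem {n : ℕ} {k : Type*} [Field k] (P Q : Ideal (MvPolynomial (Fin n) k))
    (hQ : Q ≠ ⊤) (hX : ∀ i, X i ∈ P) (hPQ : P ≤ Q) : Q ≤ P := by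
  intro f hf
  have hv : idealOfVars (Fin n) k ≤ P := by
    rw [idealOfVars, Ideal.span_le]
    rintro _ ⟨i, rfl⟩
    exact hX i
  have h1 : f - C (coeff 0 f) ∈ P := by
    apply hv
    rw [← pow_one (idealOfVars (Fin n) k), mem_pow_idealOfVars_iff']
    intro x hx
    have : x = 0 := by
      rw [← Finsupp.degree_eq_zero_iff]; omega
    subst this
    simp
  have h2 : C (coeff 0 f) ∈ Q := by
    have := Q.sub_mem hf (hPQ h1)
    simpa using this
  by_cases h0 : coeff 0 f = 0
  · simpa [h0] using h1
  · exfalso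
    apply hQ
    apply Ideal.eq_top_of_isUnit_mem _ h2
    exact (isUnit_iff_ne_zero.2 h0).map C

/-- integral linear forms -/
def Lf {n : ℕ} (k : Type*) [Field k] (l : Fin n → ℤ) : MvPolynomial (Fin n) k :=
  ∑ i, C (l i : k) * X i

theorem Lf_homog {n : ℕ} (k : Type*) [Field k] (l : Fin n → ℤ) : (Lf k l).IsHomogeneous 1 := by
  apply IsHomogeneous.sum
  intro i _
  simpa using (isHomogeneous_C (Fin n) (l i : k)).mul (isHomogeneous_X k i)

theorem exists_avoid {n : ℕ} {k : Type*} [Field k] [CharZero k]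
    (S : Finset (Ideal (MvPolynomial (Fin n) k))) (hS : ∀ P ∈ S, ∃ i, X i ∉ P) :
    ∃ l : Fin n → ℤ, ∀ P ∈ S, Lf k l ∉ P := by
  classical
  let W : Ideal (MvPolynomial (Fin n) k) → Subspace ℚ (Fin n → ℚ) := fun P =>
    { carrier := {v | ∑ i, C (v i : k) * X i ∈ P}
      add_mem' := by
        intro a b ha hb
        have := P.add_mem ha hb
        simp only [Set.mem_ofPred_eq]
        convert this using 1
        simp [add_mul, Finset.sum_add_distrib]
      zero_mem' := by simp
      smul_mem' := by
        intro c a ha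
        have := P.mul_mem_left (C (c : k)) ha
        simp only [Set.mem_ofPred_eq]
        convert this using 1
        simp [Finset.mul_sum, mul_assoc] }
  have hW : (⊤ : Subspace ℚ (Fin n → ℚ)) ∉ S.image W := by
    intro hmem
    obtain ⟨P, hP, hPt⟩ := Finset.mem_image.1 hmem
    obtain ⟨i, hi⟩ := hS P hP
    have h1 : (Pi.single i 1 : Fin n → ℚ) ∈ W P := by rw [hPt]; trivial
    apply hi
    have h2 : ∑ j, C (((Pi.single i 1 : Fin n → ℚ) j : ℚ) : k) * X j ∈ P := h1
    rw [Finset.sum_eq_single i] at h2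
    · simpa using h2
    · intro j _ hj
      simp [hj]
    · simp
  have hne := Subspace.biUnion_ne_univ_of_top_notMem hW
  obtain ⟨v, hv⟩ := (Set.ne_univ_iff_exists_notMem _).1 hne
  have hv' : ∀ P ∈ S, ∑ i, C (v i : k) * X i ∉ P := by
    intro P hP hmem
    apply hv
    simp only [Set.mem_iUnion]
    exact ⟨W P, Finset.mem_image_of_mem _ hP, hmem⟩
  obtain ⟨b, hb⟩ := IsLocalization.exist_integer_multiples_of_finite (nonZeroDivisors ℤ) v
  choose l hl using hb
  refine ⟨l, fun P hP hmem => hv' P hP ?_⟩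
  have hb0 : ((b : ℤ) : ℚ) ≠ 0 := by
    exact_mod_cast nonZeroDivisors.coe_ne_zero b
  have h3 := P.mul_mem_left (C ((((b : ℤ) : ℚ)⁻¹ : ℚ) : k)) hmem
  convert h3 using 1
  rw [Lf, Finset.mul_sum]
  apply Finset.sum_congr rfl
  intro i _
  rw [← mul_assoc, ← C_mul]
  congr 2
  have h4 := hl i
  have h5 : ((l i : ℤ) : ℚ) = ((b : ℤ) : ℚ) * v i := by
    simpa using h4
  have h6 : ((l i : ℤ) : k) = (((l i : ℤ) : ℚ) : k) := by simp
  rw [h6, h5, ← Rat.cast_mul, inv_mul_cancel_left₀ hb0]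

theorem dim_drop {n : ℕ} {k : Type*} [Field k] [CharZero k] (I : Ideal (MvPolynomial (Fin n) k))
    (m : ℕ) (h : DimLe I (m + 1)) : ∃ l : Fin n → ℤ, DimLe (I ⊔ Ideal.span {Lf k l}) m := by
  classical
  have hfin := Ideal.finite_minimalPrimes_of_isNoetherianRing _ I
  obtain ⟨l, hl⟩ := exists_avoid (hfin.toFinset.filter fun P => ∃ i, X i ∉ P)
    (fun P hP => (Finset.mem_filter.1 hP).2)
  refine ⟨l, fun c hc => ?_⟩
  have hI : I ≤ c.head.asIdeal := le_sup_left.trans hc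
  obtain ⟨P, hP, hPle⟩ := Ideal.exists_minimalPrimes_le (J := c.head.asIdeal) hI
  by_cases hX : ∃ i, X i ∉ P
  · let p' : PrimeSpectrum (MvPolynomial (Fin n) k) := ⟨P, hP.1.1⟩
    have hlt : p' < c.head := by
      refine lt_of_le_of_ne hPle ?_
      intro he
      apply hl P (Finset.mem_filter.2 ⟨hfin.mem_toFinset.2 hP, hX⟩)
      have h1 : Lf k l ∈ c.head.asIdeal :=
        hc (Ideal.mem_sup_right (Ideal.mem_span_singleton_self _))
      rw [← he] at h1
      exact h1
    have := h (c.cons p' hlt) (by simpa using hP.1.2)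
    simpa using this
  · push Not at hX
    by_contra hlen
    have hpos : 0 < c.length := by omega
    have hlt : c.head < c.last := by
      have : c.toFun 0 < c.toFun (Fin.last _) := c.strictMono (by
        rw [Fin.lt_def]; simpa using hpos)
      exact this
    have := eq_of_X_mem P c.last.asIdeal c.last.isPrime.ne_top hX (hPle.trans hlt.le)
    exact absurd (this.trans hPle) (not_le_of_gt hlt)

theorem dim_drop_all {n : ℕ} {k : Type*} [Field k] [CharZero k] (m : ℕ) :
    ∀ (I : Ideal (MvPolynomial (Fin n) k)) (_ : DimLe I m), ∃ l : Fin m → Fin n → ℤ,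
      DimLe (I ⊔ Ideal.span (Set.range fun t => Lf k (l t))) 0 := by
  induction m with
  | zero =>
    intro I h
    exact ⟨fun t => t.elim0, by simpa using h⟩
  | succ m ih =>
    intro I h
    obtain ⟨l0, hl0⟩ := dim_drop I m h
    obtain ⟨l, hl⟩ := ih _ hl0
    refine ⟨Fin.cons l0 l, ?_⟩
    convert hl using 1
    rw [sup_assoc, ← Ideal.span_union]
    congr 2
    ext P
    simp only [Set.mem_range, Set.mem_union, Set.mem_singleton_iff, Fin.exists_fin_succ,
      Fin.cons_zero, Fin.cons_succ]
    rw [eq_comm]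

theorem eval_smul_homog {n : ℕ} {k : Type*} [Field k] {e : ℕ} {g : MvPolynomial (Fin n) k}
    (hg : g.IsHomogeneous e) (x : Fin n → k) (t : k) :
    eval (fun i => x i * t) g = t ^ e * eval x g := by
  rw [eval_eq, eval_eq, Finset.mul_sum]
  apply Finset.sum_congr rfl
  intro s hs
  have h1 : s.degree = e := by
    by_contra h
    exact (mem_support_iff.1 hs) (hg.coeff_eq_zero h)
  have h2 : ∏ i ∈ s.support, (x i * t) ^ s i = t ^ e * ∏ i ∈ s.support, x i ^ s i := by
    simp only [mul_pow, Finset.prod_mul_distrib]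
    rw [Finset.prod_pow_eq_pow_sum, mul_comm, ← h1]
    rfl
  rw [h2]; ring

theorem zero_of_dim {n : ℕ} {k : Type*} [Field k] [Infinite k] {τ : Type*}
    (e : τ → ℕ) (he : ∀ t, e t ≠ 0) (G : τ → MvPolynomial (Fin n) k)
    (hG : ∀ t, (G t).IsHomogeneous (e t))
    (hd : DimLe (Ideal.span (Set.range G)) 0) (x : Fin n → k) (hx : ∀ t, eval x (G t) = 0) :
    x = 0 := by
  by_contra hne
  obtain ⟨i, hi⟩ := Function.ne_iff.1 hne
  let φ : MvPolynomial (Fin n) k →+* Polynomial k :=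
    eval₂Hom Polynomial.C (fun i => Polynomial.C (x i) * Polynomial.X)
  have hφ : ∀ f t, Polynomial.eval t (φ f) = eval (fun i => x i * t) f := by
    intro f t
    have : (Polynomial.evalRingHom t).comp φ = eval (fun i => x i * t) := by
      ext i <;> simp [φ]
    exact congrArg (fun r => r f) this
  let p1 : PrimeSpectrum (MvPolynomial (Fin n) k) := ⟨RingHom.ker φ, RingHom.ker_isPrime _⟩
  let p0 : PrimeSpectrum (MvPolynomial (Fin n) k) :=
    ⟨RingHom.ker (constantCoeff (R := k) (σ := Fin n)), RingHom.ker_isPrime _⟩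
  have hle : p1 ≤ p0 := by
    intro f hf
    have hf' : φ f = 0 := hf
    change constantCoeff f = 0
    have := hφ f 0
    rw [hf'] at this
    simp only [Polynomial.eval_zero, mul_zero] at this
    rw [← eval_zero]
    exact this.symm
  have hlt : p1 < p0 := by
    refine lt_of_le_not_ge hle ?_
    intro hcon
    have h1 : (X i : MvPolynomial (Fin n) k) ∈ p0.asIdeal := by
      change constantCoeff (X i) = 0
      simp
    have h2 : φ (X i) = 0 := hcon h1
    simp only [φ, coe_eval₂Hom, eval₂_X, mul_eq_zero, Polynomial.C_eq_zero, Polynomial.X_ne_zero,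
      or_false] at h2
    exact hi h2
  have hmem : Ideal.span (Set.range G) ≤ p1.asIdeal := by
    rw [Ideal.span_le]
    rintro _ ⟨t, rfl⟩
    change φ (G t) = 0
    apply Polynomial.funext
    intro c
    rw [hφ, eval_smul_homog (hG t), hx]
    simp
  have key : ∀ c : LTSeries (PrimeSpectrum (MvPolynomial (Fin n) k)), p1 < c.head → False := by
    intro c hc
    have := hd (c.cons p1 hc) (by simpa using hmem)
    simp at this
  exact key (RelSeries.singleton _ p0) hlt

theorem hc_mul {n : ℕ} {k : Type*} [Field k] {e N : ℕ} {g : MvPolynomial (Fin n) k}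
    (hg : g.IsHomogeneous e) (he : e ≤ N) (c : MvPolynomial (Fin n) k) (s : Fin n →₀ ℕ)
    (hs : s.degree = N) : coeff s (homogeneousComponent (N - e) c * g) = coeff s (c * g) := by
  classical
  rw [coeff_mul, coeff_mul]
  apply Finset.sum_congr rfl
  rintro ⟨a, b⟩ hab
  rw [Finset.HasAntidiagonal.mem_antidiagonal] at hab
  simp only at hab ⊢
  by_cases hb : b.degree = e
  · have : a.degree = N - e := by
      have := congrArg Finsupp.degree hab
      rw [map_add] at this
      omega
    rw [coeff_homogeneousComponent, if_pos this]
  · rw [hg.coeff_eq_zero hb]; simp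

theorem exists_good {n : ℕ} {k : Type*} [Field k] [IsAlgClosed k] [CharZero k] {τ : Type*}
    [Fintype τ] (e : τ → ℕ) (he : ∀ t, e t ≠ 0) (G : τ → MvPolynomial (Fin n) k)
    (hG : ∀ t, (G t).IsHomogeneous (e t))
    (hd : DimLe (Ideal.span (Set.range G)) 0) :
    ∃ N, 1 ≤ N ∧ (∀ t, e t ≤ N) ∧ Good N e G := by
  classical
  have hrad : idealOfVars (Fin n) k ≤ (Ideal.span (Set.range G)).radical := by
    rw [← MvPolynomial.vanishingIdeal_zeroLocus_eq_radical (K := k), idealOfVars, Ideal.span_le]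
    rintro _ ⟨i, rfl⟩
    intro x hx
    have : x = 0 := by
      apply zero_of_dim e he G hG hd
      intro t
      have := hx (G t) (Ideal.subset_span ⟨t, rfl⟩)
      simpa [coe_aeval_eq_eval] using this
    subst this
    simp
  obtain ⟨m, hm⟩ := Ideal.exists_pow_le_of_le_radical_of_fg hrad (idealOfVars_fg _ _)
  refine ⟨m + 1 + ∑ t, e t, by omega, ?_, ?_⟩
  · intro t
    have := Finset.single_le_sum (f := e) (fun _ _ => Nat.zero_le _) (Finset.mem_univ t)
    omega
  · intro s hs
    have h1 : (monomial s 1 : MvPolynomial (Fin n) k) ∈ Ideal.span (Set.range G) := by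
      apply hm
      rw [monomial_mem_pow_idealOfVars_iff _ _ one_ne_zero]
      omega
    obtain ⟨c, hc⟩ := Ideal.mem_span_range_iff_exists_fun.1 h1
    refine ⟨fun t => homogeneousComponent (m + 1 + ∑ t, e t - e t) (c t), fun t =>
      homogeneousComponent_isHomogeneous _ _, ?_⟩
    have hle : ∀ t, e t ≤ m + 1 + ∑ t, e t := by
      intro t
      have := Finset.single_le_sum (f := e) (fun _ _ => Nat.zero_le _) (Finset.mem_univ t)
      omega
    ext u
    by_cases hu : u.degree = m + 1 + ∑ t, e t
    · rw [← hc, coeff_sum, coeff_sum]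
      apply Finset.sum_congr rfl
      intro t _
      rw [hc_mul (hG t) (hle t) _ _ hu]
    · rw [coeff_monomial, if_neg (by rintro rfl; exact hu hs), coeff_sum]
      symm
      apply Finset.sum_eq_zero
      intro t _
      have := (homogeneousComponent_isHomogeneous (m + 1 + ∑ t, e t - e t) (c t)).mul (hG t)
      rw [Nat.sub_add_cancel (hle t)] at this
      exact this.coeff_eq_zero hu

end LD

namespace LD

/-- the degrees -/
def ee (n D Δ : ℕ) : Fin n ⊕ Fin Δ → ℕ := Sum.elim (fun _ => D) (fun _ => 1)

/-- the family of forms -/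
def Gf {n R Δ : ℕ} (g : Fin R → MvPolynomial (Fin n) ℤ) (b : Fin R → ℤ)
    (l : Fin Δ → Fin n → ℤ) : Fin n ⊕ Fin Δ → MvPolynomial (Fin n) Qbar :=
  Sum.elim (fun j => pderiv j (map (Int.castRingHom Qbar) (∑ i, b i • g i))) (fun t => Lf Qbar (l t))

/-- the generic family of forms -/
def GG {n R Δ : ℕ} (g : Fin R → MvPolynomial (Fin n) ℤ)
    (l : Fin Δ → Fin n → ℤ) :
    Fin n ⊕ Fin Δ → MvPolynomial (Fin n) (MvPolynomial (Fin R) Qbar) :=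
  Sum.elim (fun j => ∑ i, C (X i) * map C (pderiv j (map (Int.castRingHom Qbar) (g i))))
    (fun t => map C (Lf Qbar (l t)))

theorem map_GG {n R Δ : ℕ} (g : Fin R → MvPolynomial (Fin n) ℤ) (b : Fin R → ℤ)
    (l : Fin Δ → Fin n → ℤ) (t : Fin n ⊕ Fin Δ) :
    map (eval fun i => (b i : Qbar)) (GG g l t) = Gf g b l t := by
  have h0 : (eval fun i => (b i : Qbar)).comp (C : Qbar →+* MvPolynomial (Fin R) Qbar) =
      RingHom.id _ := by ext x; simp
  rcases t with j | t
  · simp only [GG, Gf, Sum.elim_inl, map_sum, map_mul, MvPolynomial.map_map, h0, map_C, eval_X,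
      MvPolynomial.map_id]
    apply Finset.sum_congr rfl
    intro i _
    rw [map_zsmul, map_zsmul, zsmul_eq_mul]
    simp
  · simp only [GG, Gf, Sum.elim_inr, MvPolynomial.map_map, h0, MvPolynomial.map_id]

theorem GG_homog {n R Δ D : ℕ} (g : Fin R → MvPolynomial (Fin n) ℤ)
    (hg : ∀ i, (g i).IsHomogeneous (D + 1))
    (l : Fin Δ → Fin n → ℤ) (t : Fin n ⊕ Fin Δ) : (GG g l t).IsHomogeneous (ee n D Δ t) := by
  rcases t with j | t
  · simp only [GG, ee, Sum.elim_inl]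
    apply IsHomogeneous.sum
    intro i _
    have h1 := (((hg i).map (Int.castRingHom Qbar)).pderiv (i := j)).map
      (C : Qbar →+* MvPolynomial (Fin R) Qbar)
    have := (isHomogeneous_C (Fin n) (X i : MvPolynomial (Fin R) Qbar)).mul h1
    simpa using this
  · simp only [GG, ee, Sum.elim_inr]
    exact (Lf_homog Qbar (l t)).map _

theorem uniform_good {n R Δ D : ℕ} (hD : 1 ≤ D) (g : Fin R → MvPolynomial (Fin n) ℤ)
    (hg : ∀ i, (g i).IsHomogeneous (D + 1))
    (hΔ : ∀ b : Fin R → ℤ, b ≠ 0 →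
      singDim n (map (Int.castRingHom Qbar) (∑ i, b i • g i)) ≤ ((Δ : ℕ∞) : WithBot ℕ∞)) :
    ∃ F : Finset ((Fin Δ → Fin n → ℤ) × ℕ), ∀ b : Fin R → ℤ, b ≠ 0 → ∃ i ∈ F,
      1 ≤ i.2 ∧ (∀ t, ee n D Δ t ≤ i.2) ∧ Good i.2 (ee n D Δ) (Gf g b i.1) := by
  have hhom : ∀ b l t, (Gf g b l t).IsHomogeneous (ee n D Δ t) := by
    intro b l t
    rw [← map_GG]
    exact (GG_homog g hg l t).map _
  obtain ⟨F, hF⟩ := noeth_cover (k := Qbar) (R := R)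
    (fun (i : (Fin Δ → Fin n → ℤ) × ℕ) b => 1 ≤ i.2 ∧ (∀ t, ee n D Δ t ≤ i.2) ∧
      Good i.2 (ee n D Δ) (fun t => map (eval b) (GG g i.1 t)))
    {b | ∃ b' : Fin R → ℤ, b' ≠ 0 ∧ b = fun i => (b' i : Qbar)} (by
      rintro _ ⟨b, hb, rfl⟩
      have h1 := dimLe_of_krull _ _ (hΔ b hb)
      obtain ⟨l, hl⟩ := dim_drop_all Δ _ h1
      have h2 : Ideal.span (Set.range fun j : Fin n => pderiv j
          (map (Int.castRingHom Qbar) (∑ i, b i • g i))) ⊔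
          Ideal.span (Set.range fun t => Lf Qbar (l t)) = Ideal.span (Set.range (Gf g b l)) := by
        rw [← Ideal.span_union, Gf, Set.Sum.elim_range]
      rw [h2] at hl
      have he : ∀ t, ee n D Δ t ≠ 0 := by
        rintro (j | t) <;> simp [ee]
        omega
      obtain ⟨N, hN, hN2, hgood⟩ := exists_good (ee n D Δ) he _ (hhom b l) hl
      have hgood' : Good N (ee n D Δ) (fun t => map (eval fun i => (b i : Qbar)) (GG g l t)) := by
        simp only [map_GG]; exact hgood
      obtain ⟨δ, h3, h4⟩ := good_open N (ee n D Δ) hN2 (GG g l) (GG_homog g hg l) _ hgood'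
      exact ⟨(l, N), δ, h3, fun b' hb' => ⟨hN, hN2, h4 b' hb'⟩⟩)
  refine ⟨F, fun b hb => ?_⟩
  obtain ⟨i, hi, h1, h2, h3⟩ := hF _ ⟨b, hb, rfl⟩
  refine ⟨i, hi, h1, h2, ?_⟩
  simp only [map_GG] at h3
  exact h3

theorem fibre_bound {n R Δ D : ℕ} (f : Fin R → MvPolynomial (Fin n) ℤ)
    (b : Fin R → ℤ) (l : Fin Δ → Fin n → ℤ) (N : ℕ) (hN : 1 ≤ N)
    (hN2 : ∀ t, ee n D Δ t ≤ N)
    (hgood : Good N (ee n D Δ) (Gf (fun i => homogeneousComponent (D + 1) (f i)) b l))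
    (u : Fin D → Fin n → ℤ) (c : Fin Δ → ℤ) (Z : Finset (Fin n → ℤ))
    (hZ : ∀ x ∈ Z, (∀ j, ∑ i, b i * Phi D (pderiv j (f i)) (fun t i => x i + u t i) = 0) ∧
      ∀ t, ∑ i, l t i * x i = c t) :
    Z.card ≤ Nat.card {s : Fin n →₀ ℕ | s.degree < N} := by
  classical
  set κ := Int.castRingHom Qbar with hκ
  let fb : MvPolynomial (Fin n) ℤ := ∑ i, b i • f i
  let Pj : Fin n → MvPolynomial (Fin n) Qbar := fun j => map κ (pderiv j fb)
  have hfac : (D.factorial : Qbar) ≠ 0 := by exact_mod_cast Nat.factorial_ne_zero D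
  let Gt : Fin n ⊕ Fin Δ → MvPolynomial (Fin n) Qbar :=
    Sum.elim (fun j => (D.factorial : Qbar)⁻¹ •
      Phi D (map C (Pj j)) (fun t i => (X i + C (κ (u t i)) : MvPolynomial (Fin n) Qbar)))
      (fun t => Lf Qbar (l t) - C (κ (c t)))
  have hcard : (Z.image fun x i => κ (x i)).card = Z.card := by
    apply Finset.card_image_of_injective
    intro x y hxy
    ext i
    have := congrFun hxy i
    simpa [hκ] using this
  rw [← hcard]
  apply fibre_count N hN (ee n D Δ) hN2 (Gf (fun i => homogeneousComponent (D + 1) (f i)) b l) Gt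
  · rintro (j | t)
    · have h1 := (Phi_shift D (Pj j) (fun t i => κ (u t i))).1
      rw [Phi_diag] at h1
      have h2 := Submodule.smul_mem (VV n Qbar D) (D.factorial : Qbar)⁻¹ h1
      have h3 : homogeneousComponent D (Pj j) =
          pderiv j (map κ (∑ i, b i • homogeneousComponent (D + 1) (f i))) := by
        have h4 : Pj j = pderiv j (map κ fb) := by
          simp only [Pj]; rw [pderiv_map]
        rw [h4, pderiv_hc]
        congr 1
        ext s
        simp only [coeff_homogeneousComponent, coeff_map, fb, coeff_sum, coeff_smul, smul_eq_mul]
        by_cases hs : s.degree = D + 1 <;>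
          simp [hs]
      rw [h3, smul_sub, ← Nat.cast_smul_eq_nsmul Qbar D.factorial, smul_smul,
        inv_mul_cancel₀ hfac, one_smul] at h2
      exact h2
    · simp only [Gt, Gf, ee, Sum.elim_inr]
      rw [sub_sub_cancel_left]
      exact neg_mem (VV_C _)
  · intro s hs
    obtain ⟨A, hA, hAe⟩ := hgood s hs
    exact ⟨A, fun t => homog_VV (hA t), hAe⟩
  · intro z hz t
    obtain ⟨x, hx, rfl⟩ := Finset.mem_image.1 hz
    obtain ⟨hx1, hx2⟩ := hZ x hx
    rcases t with j | t
    · simp only [Gt, Sum.elim_inl, smul_eval]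
      rw [← Phi_map (eval fun i => κ (x i))]
      have h0 : (eval fun i => κ (x i)).comp (C : Qbar →+* MvPolynomial (Fin n) Qbar) =
          RingHom.id _ := by ext x; simp
      rw [MvPolynomial.map_map, h0, MvPolynomial.map_id]
      simp only [map_add, eval_X, eval_C]
      have h1 := Phi_map κ D (pderiv j fb) (fun t i => x i + u t i)
      simp only [map_add] at h1
      have h2 : Phi D (pderiv j fb) (fun t i => x i + u t i) = 0 := by
        rw [← hx1 j]
        simp only [fb, map_sum]
        rw [Phi_sum]
        apply Finset.sum_congr rfl
        intro i _
        rw [Derivation.map_smul, Phi_smul]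
      simp only [Pj]
      rw [h1, h2]
      simp
    · simp only [Gt, Sum.elim_inr, Lf, map_sub, map_sum, map_mul, eval_C, eval_X]
      rw [← hx2 t]
      simp [hκ]

theorem count_bound {n R Δ D : ℕ} (f : Fin R → MvPolynomial (Fin n) ℤ)
    (hΔ : ∀ b : Fin R → ℤ, b ≠ 0 →
      singDim n (map (Int.castRingHom Qbar) (∑ i, b i • homogeneousComponent (D + 2) (f i))) ≤
        ((Δ : ℕ∞) : WithBot ℕ∞)) :
    ∃ Cc : ℕ, ∀ b : Fin R → ℤ, b ≠ 0 → ∀ B : ℕ, 1 ≤ B →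
      ∀ H : Finset (Fin (D + 1) → Fin n → ℤ),
      (∀ h ∈ H, (∀ t i, |h t i| ≤ B) ∧ ∀ j, ∑ i, b i * Phi (D + 1) (pderiv j (f i)) h = 0) →
      H.card ≤ Cc * B ^ (n * D + Δ) := by
  classical
  obtain ⟨F, hF⟩ := uniform_good (D := D + 1) (by omega)
    (fun i => homogeneousComponent (D + 2) (f i))
    (fun i => homogeneousComponent_isHomogeneous _ _) hΔ
  let cl : (Fin Δ → Fin n → ℤ) → ℕ := fun l => ∑ t, ∑ i, (l t i).natAbs
  let Ci : (Fin Δ → Fin n → ℤ) × ℕ → ℕ := fun i =>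
    Nat.card {s : Fin n →₀ ℕ | s.degree < i.2} * (5 ^ (n * D) * (2 * cl i.1 + 1) ^ Δ)
  refine ⟨∑ i ∈ F, Ci i, ?_⟩
  intro b hb B hB H hH
  obtain ⟨⟨l, N⟩, hi, h1, h2, h3⟩ := hF b hb
  refine le_trans ?_ (Nat.mul_le_mul_right _ (Finset.single_le_sum
    (f := Ci) (fun _ _ => Nat.zero_le _) hi))
  let T : Finset ((Fin D → Fin n → ℤ) × (Fin Δ → ℤ)) :=
    (Fintype.piFinset fun _ => Fintype.piFinset fun _ => Finset.Icc (-(2 * B : ℤ)) (2 * B)) ×ˢ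
    (Fintype.piFinset fun _ => Finset.Icc (-((cl l * B : ℕ) : ℤ)) ((cl l * B : ℕ) : ℤ))
  let ψ : (Fin (D + 1) → Fin n → ℤ) → (Fin D → Fin n → ℤ) × (Fin Δ → ℤ) := fun h =>
    (fun t i => h t.succ i - h 0 i, fun t => ∑ i, l t i * h 0 i)
  have hmaps : ∀ h ∈ H, ψ h ∈ T := by
    intro h hh
    obtain ⟨hb1, _⟩ := hH h hh
    simp only [T, ψ, Finset.mem_product, Fintype.mem_piFinset, Finset.mem_Icc]
    refine ⟨fun t i => ?_, fun t => ?_⟩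
    · have e1 := abs_le.1 (hb1 t.succ i)
      have e2 := abs_le.1 (hb1 0 i)
      constructor <;> linarith [e1.1, e1.2, e2.1, e2.2]
    · rw [← abs_le]
      calc |∑ i, l t i * h 0 i| ≤ ∑ i, |l t i * h 0 i| := Finset.abs_sum_le_sum_abs _ _
        _ ≤ ∑ i, ((l t i).natAbs : ℤ) * B := by
          apply Finset.sum_le_sum
          intro i _
          rw [abs_mul, Int.natCast_natAbs]
          exact mul_le_mul_of_nonneg_left (hb1 0 i) (abs_nonneg _)
        _ = ((∑ i, (l t i).natAbs : ℕ) : ℤ) * B := by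
          rw [← Finset.sum_mul]; push_cast; rfl
        _ ≤ ((cl l * B : ℕ) : ℤ) := by
          rw [Nat.cast_mul]
          apply mul_le_mul_of_nonneg_right _ (by positivity)
          exact_mod_cast Finset.single_le_sum (f := fun t => ∑ i, (l t i).natAbs)
            (fun _ _ => Nat.zero_le _) (Finset.mem_univ t)
  have hfib : ∀ y ∈ T, (H.filter fun h => ψ h = y).card ≤
      Nat.card {s : Fin n →₀ ℕ | s.degree < N} := by
    rintro ⟨u, c⟩ _
    have hinj : Set.InjOn (fun h : Fin (D + 1) → Fin n → ℤ => h 0)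
        (H.filter fun h => ψ h = (u, c) : Finset _) := by
      intro h hh h' hh' he
      have e1 := (Finset.mem_filter.1 (Finset.mem_coe.1 hh)).2
      have e2 := (Finset.mem_filter.1 (Finset.mem_coe.1 hh')).2
      have e3 := congrArg Prod.fst (e1.trans e2.symm)
      simp only [ψ] at e3
      simp only at he
      ext t i
      refine Fin.cases ?_ (fun t => ?_) t
      · rw [he]
      · have := congrFun (congrFun e3 t) i
        rw [he] at this
        linarith
    rw [← Finset.card_image_of_injOn hinj]
    apply fibre_bound f b l N h1 h2 h3 (Fin.cons 0 u) c
    intro x hx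
    obtain ⟨h, hh, rfl⟩ := Finset.mem_image.1 hx
    obtain ⟨hhH, hhe⟩ := Finset.mem_filter.1 hh
    simp only [ψ, Prod.mk.injEq] at hhe
    refine ⟨fun j => ?_, fun t => congrFun hhe.2 t⟩
    have : (fun (t : Fin (D + 1)) (i : Fin n) => h 0 i + (Fin.cons 0 u : Fin (D + 1) → Fin n → ℤ) t i)
        = h := by
      ext t i
      refine Fin.cases ?_ (fun t => ?_) t
      · simp
      · have := congrFun (congrFun hhe.1 t) i
        simp only [Fin.cons_succ]
        linarith
    rw [this]
    exact (hH h hhH).2 j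
  have hcard := Finset.card_le_mul_card_image_of_maps_to hmaps _ hfib
  refine hcard.trans ?_
  simp only [Ci]
  rw [mul_assoc]
  apply Nat.mul_le_mul_left
  simp only [T, Finset.card_product, Fintype.card_piFinset, Finset.prod_const, Finset.card_univ,
    Fintype.card_fin, Int.card_Icc]
  have e1 : (2 * (B : ℤ) + 1 - -(2 * B)).toNat ≤ 5 * B := by omega
  have e2 : (((cl l * B : ℕ) : ℤ) + 1 - -((cl l * B : ℕ) : ℤ)).toNat ≤ (2 * cl l + 1) * B := by
    have : (2 * cl l + 1) * B = 2 * (cl l * B) + B := by ring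
    omega
  calc _ ≤ ((5 * B) ^ n) ^ D * ((2 * cl l + 1) * B) ^ Δ := by gcongr
    _ = _ := by rw [← pow_mul, mul_pow, mul_pow, pow_add]; ring

end LD

namespace LD

theorem det_lemma {R p r : ℕ} (hp : p.Prime) (a : Fin R → ℤ) (i0 : Fin R) (ha : ¬ (p : ℤ) ∣ a i0)
    (S : Set (Fin R → ℤ)) (V : ℤ) (hV : ∀ v ∈ S, ∀ i, |v i| ≤ V)
    (hS : ∀ v ∈ S, ((p ^ r : ℕ) : ℤ) ∣ ∑ i, a i * v i)
    (hbig : (R.factorial : ℤ) * V ^ R < ((p ^ r : ℕ) : ℤ)) :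
    ∃ b : Fin R → ℤ, b ≠ 0 ∧ ∀ v ∈ S, ∑ i, b i * v i = 0 := by
  classical
  let cst : (Fin R → ℤ) → (Fin R → ℚ) := fun v i => (v i : ℚ)
  by_cases htop : Submodule.span ℚ (cst '' S) = ⊤
  · exfalso
    obtain ⟨w0, hw0, -, hli0⟩ := Submodule.exists_fun_fin_finrank_span_eq ℚ (cst '' S)
    have hfr : Module.finrank ℚ (Submodule.span ℚ (cst '' S)) = R := by
      rw [htop, finrank_top]; simp
    obtain ⟨w, hw, hli⟩ : ∃ w : Fin R → (Fin R → ℚ), (∀ i, w i ∈ cst '' S) ∧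
        LinearIndependent ℚ w :=
      ⟨fun i => w0 (finCongr hfr.symm i), fun i => hw0 _,
        hli0.comp _ (finCongr hfr.symm).injective⟩
    choose v hv hvw using hw
    let A : Matrix (Fin R) (Fin R) ℤ := Matrix.of v
    have hli' : LinearIndependent ℚ (A.map (Int.castRingHom ℚ)).row := by
      have : (A.map (Int.castRingHom ℚ)).row = w := by
        ext i j
        rw [← hvw i]
        simp [A, cst, Matrix.row]
      rw [this]
      exact hli
    rw [Matrix.linearIndependent_rows_iff_isUnit, Matrix.isUnit_iff_isUnit_det] at hli'
    have hdet : A.det ≠ 0 := by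
      intro h0
      have : (A.map (Int.castRingHom ℚ)).det = 0 := by
        have := RingHom.map_det (Int.castRingHom ℚ) A
        rw [h0, map_zero] at this
        exact this.symm
      rw [this] at hli'
      exact not_isUnit_zero hli'
    have hle : |A.det| ≤ (R.factorial : ℤ) * V ^ R := by
      have := Matrix.det_le (A := A) (abv := AbsoluteValue.abs) (x := V)
        (fun i j => hV _ (hv i) j)
      simpa using this
    have hdvd : ((p ^ r : ℕ) : ℤ) ∣ A.det * a i0 := by
      have h1 : A.adjugate.mulVec (A.mulVec a) = A.det • a := by
        rw [Matrix.mulVec_mulVec, Matrix.adjugate_mul, Matrix.smul_mulVec, Matrix.one_mulVec]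
      have h2 := congrFun h1 i0
      simp only [Pi.smul_apply, smul_eq_mul] at h2
      rw [← h2, Matrix.mulVec, dotProduct]
      apply Finset.dvd_sum
      intro j _
      apply Dvd.dvd.mul_left
      have h3 := hS _ (hv j)
      have h6 : A.mulVec a j = ∑ i, a i * v j i := by
        rw [Matrix.mulVec, dotProduct]
        exact Finset.sum_congr rfl (fun i _ => mul_comm _ _)
      exact h6 ▸ h3
    have hcop : IsCoprime ((p ^ r : ℕ) : ℤ) (a i0) := by
      push_cast
      apply IsCoprime.pow_left
      exact (Prime.coprime_iff_not_dvd (Nat.prime_iff_prime_int.1 hp)).2 ha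
    have h4 : ((p ^ r : ℕ) : ℤ) ∣ A.det := hcop.dvd_of_dvd_mul_right hdvd
    have h5 := Int.le_of_dvd (abs_pos.2 hdet) ((dvd_abs _ _).2 h4)
    linarith
  · obtain ⟨φ, hφ0, hφ⟩ := Submodule.exists_le_ker_of_lt_top _ (lt_top_iff_ne_top.2 htop)
    let c : Fin R → ℚ := fun i => φ (Pi.single i 1)
    have hφc : ∀ v : Fin R → ℚ, φ v = ∑ i, c i * v i := by
      intro v
      conv_lhs => rw [pi_eq_sum_univ' v]
      rw [map_sum]
      apply Finset.sum_congr rfl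
      intro i _
      rw [map_smul, smul_eq_mul, mul_comm]
    obtain ⟨m, hm⟩ := IsLocalization.exist_integer_multiples_of_finite (nonZeroDivisors ℤ) c
    choose b hb using hm
    have hm0 : ((m : ℤ) : ℚ) ≠ 0 := by
      exact_mod_cast nonZeroDivisors.coe_ne_zero m
    have hb' : ∀ i, ((b i : ℤ) : ℚ) = ((m : ℤ) : ℚ) * c i := by
      intro i
      simpa using hb i
    refine ⟨b, ?_, ?_⟩
    · rintro rfl
      apply hφ0
      apply LinearMap.ext
      intro v
      rw [hφc]
      have : ∀ i, c i = 0 := by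
        intro i
        have := hb' i
        simp only [Pi.zero_apply, Int.cast_zero] at this
        exact (mul_eq_zero.1 this.symm).resolve_left hm0
      simp [this]
    · intro v hv
      have h1 : φ (cst v) = 0 := hφ (Submodule.subset_span ⟨v, hv, rfl⟩)
      rw [hφc] at h1
      have : ((∑ i, b i * v i : ℤ) : ℚ) = 0 := by
        push_cast
        simp only [hb', mul_assoc]
        rw [← Finset.mul_sum, h1, mul_zero]
      exact_mod_cast this

open Classical in
theorem sum_bound {n R Δ D : ℕ} (f : Fin R → MvPolynomial (Fin n) ℤ)
    (hf : ∀ i, (f i).totalDegree ≤ D + 2)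
    (hΔ : ∀ b : Fin R → ℤ, b ≠ 0 →
      singDim n (map (Int.castRingHom Qbar) (∑ i, b i • homogeneousComponent (D + 2) (f i))) ≤
        ((Δ : ℕ∞) : WithBot ℕ∞)) (p : ℕ) (hp : p.Prime) :
    ∃ Cc c0 : ℕ, ∀ r s : ℕ, s ≤ r → c0 * (p ^ s) ^ ((D + 1) * R) < p ^ r →
      ∀ a : Fin R → ℤ, (∃ i, ¬ (p : ℤ) ∣ a i) → ∀ [NeZero (p ^ r)],
      ‖∑ x : Fin n → ZMod (p ^ r), ZMod.stdAddChar
        (eval x (map (Int.castRingHom (ZMod (p ^ r))) (∑ i, a i • f i)))‖ ^ 2 ^ (D + 1) *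
        ((p : ℝ) ^ s) ^ n ≤ Cc * ((p : ℝ) ^ s) ^ Δ * (((p : ℝ) ^ r) ^ n) ^ 2 ^ (D + 1) := by
  obtain ⟨Cc, hCc⟩ := count_bound f hΔ
  choose cb hcb using fun (i : Fin R) (j : Fin n) => Phi_bound (D + 1) (pderiv j (f i))
  let cm : ℕ := ∑ i, ∑ j, cb i j
  have hcm : ∀ i j, cb i j ≤ cm := by
    intro i j
    exact (Finset.single_le_sum (f := fun j => cb i j) (fun _ _ => Nat.zero_le _)
      (Finset.mem_univ j)).trans (Finset.single_le_sum (f := fun i => ∑ j, cb i j)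
      (fun _ _ => Nat.zero_le _) (Finset.mem_univ i))
  refine ⟨Cc, R.factorial * cm ^ R, ?_⟩
  rintro r s hsr hbig a ⟨i0, hi0⟩ _
  set q := p ^ r with hq
  set B := p ^ s with hB
  have hB0 : 0 < B := pow_pos hp.pos _
  have hqBM : q = B * p ^ (r - s) := by rw [hq, hB, ← pow_add]; congr 1; omega
  set κ := Int.castRingHom (ZMod q)
  set P := map κ (∑ i, a i • f i) with hP
  have hPV : P ∈ VV n (ZMod q) (D + 1 + 2) := by
    apply VV_map
    apply Submodule.sum_mem
    intro i _
    exact Submodule.smul_mem _ _ (VV_of_totalDegree (hf i))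
  have hPphi : ∀ j (z : Fin (D + 1) → Fin n → ℤ), Phi (D + 1) (pderiv j P) (fun t i => (z t i : ZMod q)) =
      ((∑ i, a i * Phi (D + 1) (pderiv j (f i)) z : ℤ) : ZMod q) := by
    intro j z
    have h1 := Phi_map κ (D + 1) (pderiv j (∑ i, a i • f i)) z
    rw [← pderiv_map] at h1
    rw [hP]
    refine h1.trans ?_
    rw [map_sum, Phi_sum]
    simp only [Derivation.map_smul, Phi_smul]
    rfl
  have hw := weyl_poly (D + 1) P hPV
  let E : (Fin (D + 1) → Fin n → ZMod q) → Prop := fun h => ∀ j, Phi (D + 1) (pderiv j P) h = 0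
  have hsh := shrink (SBox n q B) ((p ^ (r - s)) ^ n)
    (fun E' hE' => shrink_box n q B (p ^ (r - s)) hB0 hqBM E' hE') (D + 1) E (by
      intro h t u v h1 h2 j
      rw [Phi_slot, h1 j, h2 j, sub_zero])
  -- count lifts
  have hcount : (Finset.univ.filter fun h => E h ∧ ∀ t, SBox n q B (h t)).card ≤
      Cc * B ^ (n * D + Δ) := by
    have hlift : ∀ h : Fin (D + 1) → Fin n → ZMod q, ∃ z : Fin (D + 1) → Fin n → ℤ,
        (∀ t, SBox n q B (h t)) → (∀ t i, |z t i| ≤ B) ∧ ∀ t i, h t i = (z t i : ZMod q) := by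
      intro h
      by_cases hh : ∀ t, SBox n q B (h t)
      · choose z hz using hh
        exact ⟨z, fun _ => ⟨fun t i => ((hz t).1 i).le, fun t i => (hz t).2 i⟩⟩
      · exact ⟨0, fun h' => absurd h' hh⟩
    choose z hz using hlift
    let S : Set (Fin R → ℤ) := {v | ∃ h, (E h ∧ ∀ t, SBox n q B (h t)) ∧ ∃ j,
      v = fun i => Phi (D + 1) (pderiv j (f i)) (z h)}
    obtain ⟨b, hb0, hb⟩ := det_lemma (r := r) hp a i0 hi0 S ((cm : ℤ) * (B : ℤ) ^ (D + 1)) (by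
        rintro _ ⟨h, ⟨_, hh⟩, j, rfl⟩ i
        refine (hcb i j B (z h) (hz h hh).1).trans ?_
        gcongr
        exact_mod_cast hcm i j) (by
        rintro _ ⟨h, ⟨hE, hh⟩, j, rfl⟩
        rw [← ZMod.intCast_zmod_eq_zero_iff_dvd, ← hPphi]
        have h1 := hE j
        have h2 : h = fun t i => (z h t i : ZMod q) := by
          ext t i; exact (hz h hh).2 t i
        rw [h2] at h1
        exact h1) (by
        have : (R.factorial : ℤ) * ((cm : ℤ) * (B : ℤ) ^ (D + 1)) ^ R =
          ((R.factorial * cm ^ R * B ^ ((D + 1) * R) : ℕ) : ℤ) := by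
            push_cast
            rw [mul_pow, ← pow_mul, mul_assoc]
        rw [this]
        exact_mod_cast hbig)
    have hinj : Set.InjOn z (Finset.univ.filter fun h => E h ∧ ∀ t, SBox n q B (h t) : Finset _) := by
      intro h hh h' hh' he
      have e1 := hz h (Finset.mem_filter.1 (Finset.mem_coe.1 hh)).2.2
      have e2 := hz h' (Finset.mem_filter.1 (Finset.mem_coe.1 hh')).2.2
      ext t i
      rw [e1.2, e2.2, he]
    rw [← Finset.card_image_of_injOn hinj]
    apply hCc b hb0 B hB0
    intro y hy
    obtain ⟨h, hh, rfl⟩ := Finset.mem_image.1 hy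
    have hh' := (Finset.mem_filter.1 hh).2
    exact ⟨(hz h hh'.2).1, fun j => hb _ ⟨h, hh', j, rfl⟩⟩
  have hE2 : ((Finset.univ.filter E).card : ℝ) ≤
      (((p : ℝ) ^ (r - s)) ^ n) ^ (D + 1) * (Cc * (B : ℝ) ^ (n * D + Δ)) := by
    have h9 := hsh.trans (Nat.mul_le_mul_left _ (by convert hcount))
    have h10 : (Finset.univ.filter E).card ≤
      ((p ^ (r - s)) ^ n) ^ (D + 1) * (Cc * B ^ (n * D + Δ)) := le_of_eq_of_le (by congr) h9
    exact_mod_cast h10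
  have hfin := hw.trans (mul_le_mul_of_nonneg_left hE2 (by positivity))
  have hp0 : (0 : ℝ) < p := by exact_mod_cast hp.pos
  have hBr : (B : ℝ) = (p : ℝ) ^ s := by rw [hB]; push_cast; rfl
  have hqr : (q : ℝ) = (p : ℝ) ^ r := by rw [hq]; push_cast; rfl
  have hBM : (p : ℝ) ^ r = (p : ℝ) ^ s * (p : ℝ) ^ (r - s) := by
    rw [← pow_add]; congr 1; omega
  rw [hBr, hqr] at hfin
  set T := ‖∑ x : Fin n → ZMod q, ZMod.stdAddChar (eval x P)‖ ^ 2 ^ (D + 1)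
  set b := (p : ℝ) ^ s
  set M := (p : ℝ) ^ (r - s)
  have hb0 : 0 < b := by positivity
  have hM0 : 0 < M := by positivity
  set Q := (((p : ℝ) ^ r) ^ n) ^ 2 ^ (D + 1)
  have hpos : 0 < (M ^ n) ^ (D + 1) * b ^ (n * D) := by positivity
  refine le_of_mul_le_mul_left ?_ hpos
  calc (M ^ n) ^ (D + 1) * b ^ (n * D) * (T * b ^ n)
      = (((p : ℝ) ^ r) ^ n) ^ (D + 1) * T := by
        rw [hBM, ← pow_mul, ← pow_mul, mul_pow]; ring
    _ ≤ _ := hfin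
    _ = _ := by rw [pow_add]; ring

end LD

namespace LD

def GS {n R : ℕ} (f : Fin R → MvPolynomial (Fin n) ℤ) (ν : Fin R → ℤ) (q : ℕ) [NeZero q]
    (a : Fin R → ZMod q) : ℂ :=
  ∑ x : Fin n → ZMod q, ZMod.stdAddChar
    (∑ i, a i * (eval x (map (Int.castRingHom (ZMod q)) (f i)) - (ν i : ZMod q)))

def finZ (q : ℕ) [NeZero q] : Fin q ≃ ZMod q where
  toFun x := ((x : ℕ) : ZMod q)
  invFun y := ⟨y.val, y.val_lt⟩
  left_inv x := by
    ext
    simp [ZMod.val_cast_of_lt x.2]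
  right_inv y := by simp

theorem eC_std (q : ℕ) [NeZero q] (m : ℤ) (t : ℝ) (ht : t = (m : ℝ) / q) :
    eC t = ZMod.stdAddChar ((m : ZMod q)) := by
  rw [ZMod.stdAddChar_coe, eC, ht]
  congr 1
  push_cast
  ring

theorem eval_cast {n : ℕ} (q : ℕ) (x : Fin n → ℤ) (P : MvPolynomial (Fin n) ℤ) :
    eval (fun j => (x j : ZMod q)) (map (Int.castRingHom (ZMod q)) P) =
      ((eval x P : ℤ) : ZMod q) := by
  rw [eval_map]
  have := eval₂_comp_left (Int.castRingHom (ZMod q)) (RingHom.id ℤ) x P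
  simp only [RingHom.comp_id, eval₂_id] at this
  exact this.symm

theorem SgaussNu_eq {n R : ℕ} (f : Fin R → MvPolynomial (Fin n) ℤ) (ν : Fin R → ℤ) (q : ℕ)
    [NeZero q] (a : Fin R → ℤ) : SgaussNu f q a ν = GS f ν q (fun i => (a i : ZMod q)) := by
  rw [SgaussNu, Sgauss, Finset.sum_mul, GS]
  apply Fintype.sum_equiv (Equiv.piCongrRight (fun _ => finZ q))
  intro x
  rw [eC_std q (∑ i, a i * eval (fun j => ((x j : ℕ) : ℤ)) (f i)) _ (by push_cast; rfl),
    eC_std q (-∑ i, a i * ν i) _ (by push_cast; rfl), ← AddChar.map_add_eq_mul]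
  congr 1
  have : ∀ i, eval ((Equiv.piCongrRight (fun _ => finZ q)) x)
      (map (Int.castRingHom (ZMod q)) (f i)) =
      ((eval (fun j => ((x j : ℕ) : ℤ)) (f i) : ℤ) : ZMod q) := by
    intro i
    rw [← eval_cast]
    congr 2
    ext j
    simp [finZ]
  simp only [this]
  simp only [mul_sub, Finset.sum_sub_distrib]
  push_cast
  rw [sub_eq_add_neg]

theorem AC_sum {A : Type*} [AddCommMonoid A] (ψ : AddChar A ℂ) {m : ℕ} (g : Fin m → A) :
    ψ (∑ i, g i) = ∏ i, ψ (g i) := by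
  have := map_prod ψ.toMonoidHom (fun i => Multiplicative.ofAdd (g i)) Finset.univ
  exact this

open Classical in
theorem GS_sum {n R : ℕ} (f : Fin R → MvPolynomial (Fin n) ℤ) (ν : Fin R → ℤ) (q : ℕ)
    [NeZero q] : ∑ a, GS f ν q a = (q : ℂ) ^ R * ((Finset.univ.filter fun x : Fin n → ZMod q =>
      ∀ i, eval x (map (Int.castRingHom (ZMod q)) (f i)) = (ν i : ZMod q)).card : ℂ) := by
  simp only [GS]
  rw [Finset.sum_comm]
  have h : ∀ c : Fin R → ZMod q, ∑ a : Fin R → ZMod q, (ZMod.stdAddChar (∑ i, a i * c i) : ℂ) =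
      if (∀ i, c i = 0) then (q : ℂ) ^ R else 0 := by
    intro c
    have h1 : ∀ a : Fin R → ZMod q, (ZMod.stdAddChar (∑ i, a i * c i) : ℂ) =
      ∏ i, ZMod.stdAddChar (a i * c i) := fun a => AC_sum _ _
    simp only [h1]
    rw [← Fintype.prod_sum (fun i (t : ZMod q) => (ZMod.stdAddChar (t * c i) : ℂ))]
    simp only [AddChar.sum_mulShift _ (ZMod.isPrimitive_stdAddChar q), ZMod.card]
    split_ifs with hc
    · simp [hc]
    · push Not at hc
      obtain ⟨i, hi⟩ := hc
      exact Finset.prod_eq_zero (Finset.mem_univ i) (by simp [hi])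
  simp only [h, sub_eq_zero]
  rw [← Finset.sum_filter, Finset.sum_const, nsmul_eq_mul, mul_comm]

theorem resSet_sum {n R : ℕ} (hR : 0 < R) (f : Fin R → MvPolynomial (Fin n) ℤ) (ν : Fin R → ℤ)
    (p : ℕ) [Fact p.Prime] (r : ℕ) :
    ∑ a ∈ resSet R (p ^ r) p, SgaussNu f (p ^ r) (fun i => ((a i : ℕ) : ℤ) + 1) ν =
      ∑ a : Fin R → ZMod (p ^ r) with ∃ i, IsUnit (a i), GS f ν (p ^ r) a := by
  have hp : p.Prime := Fact.out
  apply Finset.sum_equiv (Equiv.piCongrRight (fun _ => (finZ (p ^ r)).trans (Equiv.addRight 1)))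
  · intro a
    simp only [resSet, Finset.mem_filter, Finset.mem_univ, true_and, Equiv.piCongrRight_apply]
    have h1 : ∀ i, Pi.map (fun _ => ⇑((finZ (p ^ r)).trans (Equiv.addRight 1))) a i =
        (((a i : ℕ) + 1 : ℕ) : ZMod (p ^ r)) := by
      intro i; simp [finZ]
    simp only [h1, ZMod.isUnit_iff_coprime]
    rcases Nat.eq_zero_or_pos r with rfl | hr
    · have : ∀ i, (a i : ℕ) = 0 := by
        intro i
        have h0 := (a i).2
        have h00 : p ^ 0 = 1 := pow_zero p
        omega
      simp only [this]
      constructor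
      · intro _
        exact ⟨⟨0, hR⟩, by simp⟩
      · intro _
        have h2 : (Finset.univ.gcd fun _ : Fin R => 0 + 1) = 1 := by
          apply Nat.dvd_one.1
          exact Finset.gcd_dvd (f := fun _ : Fin R => 0 + 1) (Finset.mem_univ (⟨0, hR⟩ : Fin R))
        rw [h2]; simp
    · have h2 : ∀ m : ℕ, m.Coprime (p ^ r) ↔ ¬ p ∣ m := by
        intro m
        rw [Nat.coprime_pow_right_iff hr, Nat.coprime_comm, hp.coprime_iff_not_dvd]
      simp only [h2]
      change Nat.Coprime _ _ ↔ _
      rw [Nat.coprime_comm, hp.coprime_iff_not_dvd, Finset.dvd_gcd_iff]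
      simp
  · intro a _
    rw [SgaussNu_eq]
    congr 1
    ext i
    simp [finZ]

theorem std_mul (p N : ℕ) [Fact p.Prime] (y : ZMod (p ^ (N + 1))) :
    (ZMod.stdAddChar ((p : ZMod (p ^ (N + 1))) * y) : ℂ) =
      ZMod.stdAddChar (ZMod.castHom (pow_dvd_pow p (Nat.le_succ N)) (ZMod (p ^ N)) y) := by
  obtain ⟨m, rfl⟩ := ZMod.intCast_surjective y
  have : (p : ZMod (p ^ (N + 1))) * (m : ZMod (p ^ (N + 1))) = (((p * m : ℤ)) : ZMod _) := by
    push_cast; rfl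
  rw [this, map_intCast (ZMod.castHom (pow_dvd_pow p (Nat.le_succ N)) (ZMod (p ^ N))), ZMod.stdAddChar_coe, ZMod.stdAddChar_coe]
  congr 1
  have hp : (p : ℂ) ≠ 0 := by exact_mod_cast (Fact.out : p.Prime).ne_zero
  push_cast
  rw [pow_succ]
  field_simp

theorem sum_fibre (n p N : ℕ) [Fact p.Prime] (g : (Fin n → ZMod (p ^ N)) → ℂ) :
    ∑ x : Fin n → ZMod (p ^ (N + 1)), g (fun j =>
      ZMod.castHom (pow_dvd_pow p (Nat.le_succ N)) (ZMod (p ^ N)) (x j)) =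
      (p : ℂ) ^ n * ∑ y, g y := by
  classical
  let c := ZMod.castHom (pow_dvd_pow p (Nat.le_succ N)) (ZMod (p ^ N))
  let φ : (Fin n → ZMod (p ^ (N + 1))) →+ (Fin n → ZMod (p ^ N)) :=
    AddMonoidHom.compLeft c.toAddMonoidHom (Fin n)
  have hc : Function.Surjective c := ZMod.castHom_surjective _
  have hφ : Function.Surjective φ := by
    intro y
    choose x hx using fun j => hc (y j)
    exact ⟨x, funext hx⟩
  let k := (Finset.univ.filter fun x => φ x = 0).card
  have hk : ∀ y, (Finset.univ.filter fun x => φ x = y).card = k := by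
    intro y
    exact AddMonoidHom.card_fiber_eq_of_mem_range φ (hφ y) (hφ 0)
  have hmain : ∀ h : (Fin n → ZMod (p ^ N)) → ℂ, ∑ x, h (φ x) = k * ∑ y, h y := by
    intro h
    rw [← Finset.sum_fiberwise Finset.univ φ (fun x => h (φ x)), Finset.mul_sum]
    apply Finset.sum_congr rfl
    intro y _
    rw [← hk y, ← nsmul_eq_mul, ← Finset.sum_const]
    apply Finset.sum_congr rfl
    intro x hx
    rw [(Finset.mem_filter.1 hx).2]
  have hk2 : (k : ℂ) = (p : ℂ) ^ n := by
    have h1 := hmain (fun _ => 1)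
    simp only [Finset.sum_const, Finset.card_univ, Fintype.card_fun, ZMod.card, Fintype.card_fin,
      nsmul_eq_mul, mul_one] at h1
    have hp : (p : ℂ) ≠ 0 := by exact_mod_cast (Fact.out : p.Prime).ne_zero
    push_cast at h1
    have h2 : ((p : ℂ) ^ N) ^ n ≠ 0 := by positivity
    apply mul_right_cancel₀ h2
    rw [← h1, pow_succ]
    ring
  rw [← hk2]
  exact hmain g

theorem GS_nonprim {n R : ℕ} (f : Fin R → MvPolynomial (Fin n) ℤ) (ν : Fin R → ℤ)
    (p N : ℕ) [Fact p.Prime] (b : Fin R → ZMod (p ^ (N + 1))) :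
    GS f ν (p ^ (N + 1)) (fun i => (p : ZMod (p ^ (N + 1))) * b i) =
      (p : ℂ) ^ n * GS f ν (p ^ N) (fun i =>
        ZMod.castHom (pow_dvd_pow p (Nat.le_succ N)) (ZMod (p ^ N)) (b i)) := by
  rw [GS, GS, ← sum_fibre]
  apply Finset.sum_congr rfl
  intro x _
  simp only [mul_assoc]
  rw [← Finset.mul_sum, std_mul, map_sum]
  congr 1
  apply Finset.sum_congr rfl
  intro i _
  rw [map_mul, map_sub, map_intCast]
  congr 2
  set c := ZMod.castHom (pow_dvd_pow p (Nat.le_succ N)) (ZMod (p ^ N))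
  rw [eval_map, eval_map, ← coe_eval₂Hom, ← coe_eval₂Hom, map_eval₂Hom]
  congr 1
  congr 1
  exact Subsingleton.elim _ _

theorem GS_step {n R : ℕ} (f : Fin R → MvPolynomial (Fin n) ℤ) (ν : Fin R → ℤ)
    (p N : ℕ) [Fact p.Prime] :
    ∑ a, GS f ν (p ^ (N + 1)) a =
      (∑ a : Fin R → ZMod (p ^ (N + 1)) with ∃ i, IsUnit (a i), GS f ν (p ^ (N + 1)) a) +
      (p : ℂ) ^ n * ∑ a, GS f ν (p ^ N) a := by
  classical
  have hp : p.Prime := Fact.out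
  rw [← Finset.sum_filter_add_sum_filter_not Finset.univ (fun a => ∃ i, IsUnit (a i))]
  congr 1
  rw [Finset.mul_sum]
  symm
  have hlt : ∀ b : ZMod (p ^ N), p * b.val < p ^ (N + 1) := by
    intro b
    rw [pow_succ, mul_comm]
    exact Nat.mul_lt_mul_of_pos_right b.val_lt hp.pos
  have hnu : ∀ a : ZMod (p ^ (N + 1)), ¬ IsUnit a → p ∣ a.val := by
    intro a ha
    rw [← ZMod.natCast_zmod_val a, ZMod.isUnit_iff_coprime, Nat.coprime_pow_right_iff (Nat.succ_pos _),
      Nat.coprime_comm, hp.coprime_iff_not_dvd, not_not] at ha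
    exact ha
  apply Finset.sum_nbij' (fun (b : Fin R → ZMod (p ^ N)) i => ((p * (b i).val : ℕ) : ZMod (p ^ (N + 1))))
    (fun a i => (((a i).val / p : ℕ) : ZMod (p ^ N)))
  · intro b _
    simp only [Finset.mem_filter, Finset.mem_univ, true_and, not_exists]
    intro i
    rw [ZMod.isUnit_iff_coprime, Nat.coprime_pow_right_iff (Nat.succ_pos _),
      Nat.coprime_comm, hp.coprime_iff_not_dvd, not_not]
    exact Dvd.intro _ rfl
  · intro a _
    exact Finset.mem_univ _
  · intro b _
    ext i
    rw [ZMod.val_cast_of_lt (hlt _), Nat.mul_div_cancel_left _ hp.pos, ZMod.natCast_zmod_val]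
  · intro a ha
    ext i
    have ha' := hnu (a i) (fun h => (Finset.mem_filter.1 ha).2 ⟨i, h⟩)
    rw [ZMod.val_cast_of_lt, Nat.mul_div_cancel' ha', ZMod.natCast_zmod_val]
    rw [Nat.div_lt_iff_lt_mul hp.pos, ← pow_succ]
    exact (a i).val_lt
  · intro b _
    have := GS_nonprim f ν p N (fun i => (((b i).val : ℕ) : ZMod (p ^ (N + 1))))
    simp only [map_natCast, ZMod.natCast_zmod_val] at this
    rw [← this]
    congr 1
    ext i
    push_cast
    rfl

def TT {n R : ℕ} (f : Fin R → MvPolynomial (Fin n) ℤ) (ν : Fin R → ℤ) (p r : ℕ) : ℂ :=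
  ((p : ℂ) ^ (r * n))⁻¹ *
    ∑ a ∈ resSet R (p ^ r) p, SgaussNu f (p ^ r) (fun i => ((a i : ℕ) : ℤ) + 1) ν

theorem partial_sum {n R : ℕ} (hR : 0 < R) (f : Fin R → MvPolynomial (Fin n) ℤ) (ν : Fin R → ℤ)
    (p : ℕ) [Fact p.Prime] (N : ℕ) :
    ∑ r ∈ Finset.range (N + 1), TT f ν p r = ((p : ℂ) ^ (N * n))⁻¹ * ∑ a, GS f ν (p ^ N) a := by
  have hp : (p : ℂ) ≠ 0 := by exact_mod_cast (Fact.out : p.Prime).ne_zero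
  induction N with
  | zero =>
    rw [Finset.sum_range_one, TT, resSet_sum hR]
    congr 1
    apply Finset.sum_congr _ (fun _ _ => rfl)
    ext a
    simp only [Finset.mem_filter, Finset.mem_univ, true_and, iff_true]
    refine ⟨⟨0, hR⟩, ?_⟩
    have : Subsingleton (ZMod (p ^ 0)) := by rw [pow_zero]; infer_instance
    exact isUnit_of_subsingleton _
  | succ N ih =>
    rw [Finset.sum_range_succ, ih, TT, resSet_sum hR, GS_step f ν p N]
    rw [mul_add, add_comm]
    congr 1
    rw [← mul_assoc]
    congr 1
    rw [Nat.add_mul, one_mul, pow_add]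
    field_simp

end LD

namespace LD

theorem GS_norm {n R : ℕ} (f : Fin R → MvPolynomial (Fin n) ℤ) (ν : Fin R → ℤ) (q : ℕ)
    [NeZero q] (a : Fin R → ℤ) : ‖GS f ν q (fun i => (a i : ZMod q))‖ =
    ‖∑ x : Fin n → ZMod q, (ZMod.stdAddChar
        (eval x (map (Int.castRingHom (ZMod q)) (∑ i, a i • f i))) : ℂ)‖ := by
  have h : GS f ν q (fun i => (a i : ZMod q)) = (∑ x : Fin n → ZMod q, (ZMod.stdAddChar
        (eval x (map (Int.castRingHom (ZMod q)) (∑ i, a i • f i))) : ℂ)) *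
        ZMod.stdAddChar (-∑ i, (a i : ZMod q) * (ν i : ZMod q)) := by
    rw [GS, Finset.sum_mul]
    apply Finset.sum_congr rfl
    intro x _
    rw [← AddChar.map_add_eq_mul]
    congr 1
    simp only [mul_sub, Finset.sum_sub_distrib, map_sum, zsmul_eq_mul, map_mul, map_intCast]
    rw [sub_eq_add_neg]
  rw [h, norm_mul, AddChar.norm_apply, mul_one]

theorem arith_bound (k R n Δ p r s t1 Cc : ℕ) (hp : 1 ≤ p) (X : ℝ) (hX : 0 ≤ X)
    (hn : Δ + 2 ^ k * (R * (R + 1) * k) ≤ n) (hr : r ≤ t1 + k * R * s)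
    (hb : X ^ 2 ^ k * ((p : ℝ) ^ s) ^ n ≤ Cc * ((p : ℝ) ^ s) ^ Δ * (((p : ℝ) ^ r) ^ n) ^ 2 ^ k) :
    X * (p : ℝ) ^ (r * (R + 1)) ≤ ((Cc + 1) * (p : ℝ) ^ (t1 * (R + 1))) * ((p : ℝ) ^ r) ^ n := by
  have hp1 : (1 : ℝ) ≤ p := by exact_mod_cast hp
  have hp0 : (0 : ℝ) < p := by linarith
  set Q := ((p : ℝ) ^ r) ^ n
  have hQ : 0 < Q := by positivity
  have h1 : X * (p : ℝ) ^ (s * (k * R * (R + 1))) ≤ (Cc + 1) * Q := by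
    refine le_of_pow_le_pow_left₀ (n := 2 ^ k) (by positivity) (by positivity) ?_
    rw [mul_pow, mul_pow]
    have hb0 : (0 : ℝ) < ((p : ℝ) ^ s) ^ Δ := by positivity
    refine le_of_mul_le_mul_right ?_ hb0
    calc X ^ 2 ^ k * ((p : ℝ) ^ (s * (k * R * (R + 1)))) ^ 2 ^ k * ((p : ℝ) ^ s) ^ Δ
        = X ^ 2 ^ k * ((p : ℝ) ^ s) ^ (Δ + 2 ^ k * (R * (R + 1) * k)) := by
          rw [mul_assoc]; congr 1
          simp only [← pow_mul, ← pow_add]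
          congr 1; ring
      _ ≤ X ^ 2 ^ k * ((p : ℝ) ^ s) ^ n := by
          gcongr
          exact one_le_pow₀ hp1
      _ ≤ _ := hb
      _ = (Cc : ℝ) * Q ^ 2 ^ k * ((p : ℝ) ^ s) ^ Δ := by ring
      _ ≤ ((Cc : ℝ) + 1) ^ 2 ^ k * Q ^ 2 ^ k * ((p : ℝ) ^ s) ^ Δ := by
          gcongr
          calc (Cc : ℝ) ≤ (Cc + 1) ^ 1 := by rw [pow_one]; linarith
            _ ≤ _ := pow_le_pow_right₀ (by linarith [Nat.cast_nonneg (α := ℝ) Cc])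
              Nat.one_le_two_pow
  calc X * (p : ℝ) ^ (r * (R + 1)) ≤ X * (p : ℝ) ^ ((t1 + k * R * s) * (R + 1)) := by
        gcongr
    _ = X * (p : ℝ) ^ (s * (k * R * (R + 1))) * (p : ℝ) ^ (t1 * (R + 1)) := by
        rw [mul_assoc X, ← pow_add]; congr 2; ring
    _ ≤ ((Cc + 1) * Q) * (p : ℝ) ^ (t1 * (R + 1)) := by gcongr
    _ = _ := by ring

theorem summable_TT {n R Δ D : ℕ} (hR : 0 < R) (f : Fin R → MvPolynomial (Fin n) ℤ)
    (hf : ∀ i, (f i).totalDegree ≤ D + 2)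
    (hΔ : ∀ b : Fin R → ℤ, b ≠ 0 →
      singDim n (map (Int.castRingHom Qbar) (∑ i, b i • homogeneousComponent (D + 2) (f i))) ≤
        ((Δ : ℕ∞) : WithBot ℕ∞)) (p : ℕ) [Fact p.Prime] (ν : Fin R → ℤ)
    (hn : Δ + 2 ^ (D + 1) * (R * (R + 1) * (D + 1)) ≤ n) :
    Summable (TT f ν p) := by
  have hp : p.Prime := Fact.out
  have hp0 : (0 : ℝ) < p := by exact_mod_cast hp.pos
  obtain ⟨Cc, c0, hb⟩ := sum_bound f hf hΔ p hp
  obtain ⟨t0, ht0⟩ : ∃ t0, c0 < p ^ t0 := ⟨c0, Nat.lt_pow_self hp.one_lt⟩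
  set k := D + 1 with hk
  have hkR : 0 < k * R := Nat.mul_pos (Nat.succ_pos _) hR
  let C2 : ℝ := (Cc + 1) * (p : ℝ) ^ ((t0 + k * R) * (R + 1))
  apply Summable.of_norm_bounded_eventually_nat (g := fun r => C2 * ((p : ℝ)⁻¹) ^ r)
  · apply Summable.mul_left
    apply summable_geometric_of_lt_one (by positivity)
    exact inv_lt_one_of_one_lt₀ (by exact_mod_cast hp.one_lt)
  · filter_upwards [eventually_ge_atTop (t0 + 1)] with r hr
    let s := (r - t0) / (k * R)
    have hs1 : k * R * s ≤ r - t0 := Nat.mul_div_le _ _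
    have hs2 : r - t0 < k * R * s + k * R := Nat.lt_mul_div_succ _ hkR
    have hsr : s ≤ r := (Nat.div_le_self _ _).trans (Nat.sub_le _ _)
    have hbig : c0 * (p ^ s) ^ (k * R) < p ^ r := by
      calc c0 * (p ^ s) ^ (k * R) < p ^ t0 * (p ^ s) ^ (k * R) :=
            Nat.mul_lt_mul_of_pos_right ht0 (pow_pos (pow_pos hp.pos _) _)
        _ = p ^ (t0 + k * R * s) := by rw [← pow_mul, ← pow_add, mul_comm s]
        _ ≤ p ^ r := Nat.pow_le_pow_right hp.pos (by omega)
    have hG : ∀ a : Fin R → ZMod (p ^ r), (∃ i, IsUnit (a i)) →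
        ‖GS f ν (p ^ r) a‖ * (p : ℝ) ^ (r * (R + 1)) ≤ C2 * ((p : ℝ) ^ r) ^ n := by
      rintro a ⟨i, hi⟩
      have h1 := hb r s hsr hbig (fun i => ((a i).val : ℤ)) ⟨i, by
        rw [← ZMod.natCast_zmod_val (a i), ZMod.isUnit_iff_coprime,
          Nat.coprime_pow_right_iff (by omega), Nat.coprime_comm, hp.coprime_iff_not_dvd] at hi
        exact_mod_cast hi⟩
      rw [← GS_norm f ν] at h1
      simp only [Int.cast_natCast, ZMod.natCast_zmod_val] at h1
      exact arith_bound k R n Δ p r s (t0 + k * R) Cc hp.one_lt.le _ (norm_nonneg _) hn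
        (by omega) h1
    rw [TT, resSet_sum hR, norm_mul, norm_inv, norm_pow, Complex.norm_natCast]
    have h2 : ‖∑ a : Fin R → ZMod (p ^ r) with ∃ i, IsUnit (a i), GS f ν (p ^ r) a‖ ≤
        ((p : ℝ) ^ r) ^ R * (C2 * ((p : ℝ) ^ r) ^ n / (p : ℝ) ^ (r * (R + 1))) := by
      refine (norm_sum_le_of_le _ (f := fun a => GS f ν (p ^ r) a)
        (n := fun _ => C2 * ((p : ℝ) ^ r) ^ n / (p : ℝ) ^ (r * (R + 1))) ?_).trans ?_
      · intro a ha
        rw [le_div_iff₀ (by positivity)]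
        exact hG a (Finset.mem_filter.1 ha).2
      · rw [Finset.sum_const, nsmul_eq_mul]
        gcongr
        refine (Nat.cast_le.2 (Finset.card_filter_le _ _)).trans ?_
        rw [Finset.card_univ, Fintype.card_fun, ZMod.card, Fintype.card_fin]
        push_cast
        exact le_rfl
    calc ((p : ℝ) ^ (r * n))⁻¹ * _ ≤ ((p : ℝ) ^ (r * n))⁻¹ *
          (((p : ℝ) ^ r) ^ R * (C2 * ((p : ℝ) ^ r) ^ n / (p : ℝ) ^ (r * (R + 1)))) := by
            gcongr
      _ = C2 * ((p : ℝ)⁻¹) ^ r := by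
        rw [inv_pow, mul_add, mul_one, pow_add, pow_mul, pow_mul]
        field_simp

end LD

namespace LD

theorem taylor1 {n : ℕ} {S : Type*} [CommRing S] (P : MvPolynomial (Fin n) S) (x z : Fin n → S)
    (π : S) (hz : ∀ j, π ∣ z j) : π ∣ eval (x + z) P - eval x P := by
  induction P using MvPolynomial.induction_on with
  | C a => simp
  | add P Q hP hQ =>
    have := dvd_add hP hQ
    convert this using 1
    simp only [map_add]; ring
  | mul_X P k hP =>
    simp only [map_mul, eval_X, Pi.add_apply]
    have := dvd_add (hP.mul_right (x k + z k)) ((hz k).mul_left (eval x P))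
    convert this using 1
    ring

theorem taylor2 {n : ℕ} {S : Type*} [CommRing S] (P : MvPolynomial (Fin n) S) (x z : Fin n → S)
    (π : S) (hz : ∀ j, π ∣ z j) :
    π ^ 2 ∣ eval (x + z) P - eval x P - ∑ j, z j * eval x (pderiv j P) := by
  induction P using MvPolynomial.induction_on with
  | C a => simp
  | add P Q hP hQ =>
    have := dvd_add hP hQ
    convert this using 1
    simp only [map_add, mul_add, Finset.sum_add_distrib]; ring
  | mul_X P k hP =>
    have h1 : ∑ j, z j * eval x (pderiv j (P * X k)) =
        (∑ j, z j * eval x (pderiv j P)) * x k + eval x P * z k := by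
      have : ∀ j, z j * eval x (pderiv j (P * X k)) =
          z j * eval x (pderiv j P) * x k + (if j = k then eval x P * z k else 0) := by
        intro j
        rw [Derivation.leibniz, pderiv_X]
        by_cases hjk : j = k
        · subst hjk
          simp; ring
        · simp [hjk, Ne.symm hjk]; ring
      simp only [this, Finset.sum_add_distrib, Finset.sum_mul]
      simp
    rw [h1]
    simp only [map_mul, eval_X, Pi.add_apply]
    have h2 := mul_dvd_mul (taylor1 P x z π hz) (hz k)
    rw [← pow_two] at h2
    have := dvd_add (hP.mul_right (x k)) h2
    convert this using 1
    ring

theorem newton {n R p : ℕ} [Fact p.Prime] (P : Fin R → MvPolynomial (Fin n) ℤ_[p])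
    (σ : Fin R ↪ Fin n) (x₀ : Fin n → ℤ_[p]) (c : Fin R → ℤ_[p]) (e : ℕ) (u₀ : ℤ_[p]ˣ)
    (hdet : eval x₀ (Matrix.det (Matrix.of fun i k => pderiv (σ k) (P i))) = u₀ * (p : ℤ_[p]) ^ e)
    (hx : ∀ i, eval x₀ (P i) = c i) (y₀ : Fin n → ℤ_[p])
    (hy₀ : ∀ j, (p : ℤ_[p]) ^ (2 * e + 1) ∣ y₀ j - x₀ j) (k : ℕ) :
    ∃ y : Fin n → ℤ_[p], (∀ j, j ∉ Set.range σ → y j = y₀ j) ∧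
      (∀ j, (p : ℤ_[p]) ^ (e + 1) ∣ y j - x₀ j) ∧
      ∀ i, (p : ℤ_[p]) ^ (2 * e + 1 + k) ∣ eval y (P i) - c i := by
  induction k with
  | zero =>
    refine ⟨y₀, fun _ _ => rfl, fun j => (pow_dvd_pow _ (by omega)).trans (hy₀ j), fun i => ?_⟩
    have := taylor1 (P i) x₀ (y₀ - x₀) _ hy₀
    rw [add_sub_cancel, hx] at this
    exact this
  | succ k ih =>
    obtain ⟨y, hy1, hy2, hy3⟩ := ih
    choose v hv using hy3
    let J : Matrix (Fin R) (Fin R) ℤ_[p] := Matrix.of fun i k => eval y (pderiv (σ k) (P i))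
    have hJ : J.det = eval y (Matrix.det (Matrix.of fun i k => pderiv (σ k) (P i))) := by
      rw [RingHom.map_det]; rfl
    obtain ⟨u, hu⟩ : ∃ u : ℤ_[p]ˣ, J.det = u * (p : ℤ_[p]) ^ e := by
      have h1 := taylor1 (Matrix.det (Matrix.of fun i k => pderiv (σ k) (P i))) x₀ (y - x₀) _ hy2
      rw [add_sub_cancel, ← hJ, hdet] at h1
      obtain ⟨w, hw⟩ := h1
      have h2 : J.det = ((u₀ : ℤ_[p]) + p * w) * (p : ℤ_[p]) ^ e := by
        rw [sub_eq_iff_eq_add] at hw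
        rw [hw]; ring
      have h3 : IsUnit ((u₀ : ℤ_[p]) + p * w) := by
        by_contra hcon
        have h4 : -((p : ℤ_[p]) * w) ∈ nonunits ℤ_[p] := by
          intro h5
          rw [IsUnit.neg_iff] at h5
          exact PadicInt.p_nonunit (isUnit_of_mul_isUnit_left h5)
        have h6 := IsLocalRing.nonunits_add hcon h4
        rw [add_neg_cancel_right] at h6
        exact h6 u₀.isUnit
      exact ⟨h3.unit, h2⟩
    let w : Fin R → ℤ_[p] := fun m => (p : ℤ_[p]) ^ (e + 1 + k) * (-(((u⁻¹ : ℤ_[p]ˣ) : ℤ_[p]) * (J.adjugate.mulVec v) m))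
    let z : Fin n → ℤ_[p] := Function.extend σ w 0
    have hzσ : ∀ m, z (σ m) = w m := fun m => σ.injective.extend_apply _ _ _
    have hz0 : ∀ j, j ∉ Set.range σ → z j = 0 := fun j hj =>
      Function.extend_apply' _ _ _ hj
    have hzd : ∀ j, (p : ℤ_[p]) ^ (e + 1 + k) ∣ z j := by
      intro j
      by_cases hj : j ∈ Set.range σ
      · obtain ⟨m, rfl⟩ := hj
        rw [hzσ]
        exact Dvd.intro _ rfl
      · rw [hz0 j hj]; exact dvd_zero _
    refine ⟨y + z, ?_, ?_, ?_⟩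
    · intro j hj
      rw [Pi.add_apply, hz0 j hj, add_zero, hy1 j hj]
    · intro j
      rw [Pi.add_apply, add_sub_right_comm]
      exact dvd_add (hy2 j) ((pow_dvd_pow _ (by omega)).trans (hzd j))
    · intro i
      have h1 := taylor2 (P i) y z _ hzd
      have h2 : ∑ j, z j * eval y (pderiv j (P i)) = J.mulVec w i := by
        rw [Matrix.mulVec, dotProduct]
        symm
        apply Finset.sum_of_injOn σ σ.injective.injOn (fun _ _ => Finset.mem_coe.2 (Finset.mem_univ _))
        · intro j _ hj
          rw [hz0 j (by simpa using hj), zero_mul]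
        · intro m _
          rw [hzσ, mul_comm]; rfl
      have h3 : J.mulVec w = (-((p : ℤ_[p]) ^ (2 * e + 1 + k))) • v := by
        have : w = (-((p : ℤ_[p]) ^ (e + 1 + k) * ((u⁻¹ : ℤ_[p]ˣ) : ℤ_[p]))) • J.adjugate.mulVec v := by
          ext m
          simp only [w, Pi.smul_apply, smul_eq_mul]; ring
        rw [this, Matrix.mulVec_smul, Matrix.mulVec_mulVec, Matrix.mul_adjugate, hu,
          Matrix.smul_mulVec, Matrix.one_mulVec, smul_smul]
        congr 1
        have h5 : ((u⁻¹ : ℤ_[p]ˣ) : ℤ_[p]) * u = 1 := by simp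
        calc _ = -((((u⁻¹ : ℤ_[p]ˣ) : ℤ_[p]) * u) * ((p : ℤ_[p]) ^ (e + 1 + k) * (p : ℤ_[p]) ^ e)) := by ring
          _ = _ := by rw [h5, one_mul, ← pow_add]; congr 2; omega
      rw [h2, h3] at h1
      have h6 : eval (y + z) (P i) - eval y (P i) - (-((p : ℤ_[p]) ^ (2 * e + 1 + k)) • v) i =
          eval (y + z) (P i) - c i := by
        have := hv i
        simp only [Pi.smul_apply, smul_eq_mul]
        linear_combination -this
      rw [h6, ← pow_mul] at h1
      exact (pow_dvd_pow _ (by omega)).trans h1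

open Classical in
theorem hensel_count {n R p : ℕ} [Fact p.Prime] (f : Fin R → MvPolynomial (Fin n) ℤ)
    (ν : Fin R → ℤ) (x₀ : Fin n → ℤ_[p]) (hsol : ∀ i, aeval x₀ (f i) = (ν i : ℤ_[p]))
    (I : Finset (Fin n)) (hI : I.card = R) (e : ℕ) (u₀ : ℤ_[p]ˣ)
    (hdet : aeval x₀ (jacMinor f I hI) = u₀ * (p : ℤ_[p]) ^ e) (M : ℕ) :
    (p ^ M) ^ (n - R) ≤ (Finset.univ.filter fun x : Fin n → ZMod (p ^ (2 * e + 1 + M)) =>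
      ∀ i, eval x (map (Int.castRingHom _) (f i)) = (ν i : ZMod _)).card := by
  have hp : p.Prime := Fact.out
  have hev : ∀ (y : Fin n → ℤ_[p]) (Q : MvPolynomial (Fin n) ℤ),
      eval y (map (Int.castRingHom ℤ_[p]) Q) = aeval y Q := by
    intro y Q
    rw [eval_map, aeval_def, algebraMap_int_eq]
  let σ : Fin R ↪ Fin n := (I.orderEmbOfFin hI).toEmbedding
  have hσ : Set.range σ = (I : Set (Fin n)) := Finset.range_orderEmbOfFin I hI
  let T := {j : Fin n // j ∉ I} → Fin (p ^ M)
  let y₀ : T → Fin n → ℤ_[p] := fun t j =>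
    if h : j ∉ I then x₀ j + (p : ℤ_[p]) ^ (2 * e + 1) * ((t ⟨j, h⟩ : ℕ) : ℤ_[p]) else x₀ j
  have hy₀ : ∀ t j, (p : ℤ_[p]) ^ (2 * e + 1) ∣ y₀ t j - x₀ j := by
    intro t j
    by_cases h : j ∉ I
    · simp only [y₀, dif_pos h, add_sub_cancel_left]
      exact Dvd.intro _ rfl
    · simp only [y₀, dif_neg h, sub_self, dvd_zero]
  have hex := fun t => newton (fun i => map (Int.castRingHom ℤ_[p]) (f i)) σ x₀
    (fun i => (ν i : ℤ_[p])) e u₀ (by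
      rw [← hdet, ← hev, jacMinor]
      congr 1
      rw [RingHom.map_det]
      congr 1
      ext1 i k
      simp only [Matrix.of_apply, RingHom.mapMatrix_apply, Matrix.map_apply, pderiv_map]
      rfl) (fun i => (hev _ _).trans (hsol i)) (y₀ t) (hy₀ t) M
  choose y hy1 hy2 hy3 using hex
  set N := 2 * e + 1 + M
  have hker : ∀ a b : ℤ_[p], PadicInt.toZModPow N a = PadicInt.toZModPow N b ↔
      (p : ℤ_[p]) ^ N ∣ a - b := by
    intro a b
    rw [← sub_eq_zero, ← map_sub, ← RingHom.mem_ker, PadicInt.ker_toZModPow,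
      Ideal.mem_span_singleton]
  have hcardT : Fintype.card T = (p ^ M) ^ (n - R) := by
    rw [Fintype.card_fun, Fintype.card_fin]
    congr 1
    rw [Fintype.card_subtype_compl]
    simp [hI]
  rw [← hcardT, ← Finset.card_univ]
  apply Finset.card_le_card_of_injOn (fun t j => PadicInt.toZModPow N (y t j))
  · intro t _
    simp only [Finset.coe_filter, Finset.mem_univ, true_and, Set.mem_ofPred_eq]
    intro i
    have h1 := (hker _ _).2 (hy3 t i)
    rw [map_intCast] at h1
    rw [← h1, eval_map, eval_map, ← coe_eval₂Hom, ← coe_eval₂Hom, map_eval₂Hom]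
    congr 1
    congr 1
    exact Subsingleton.elim _ _
  · intro t _ t' _ htt
    funext ⟨j, hj⟩
    have h1 := (hker _ _).1 (congrFun htt j)
    have hj' : j ∉ Set.range σ := by rw [hσ]; exact_mod_cast hj
    rw [hy1 t j hj', hy1 t' j hj'] at h1
    simp only [y₀, dif_pos hj] at h1
    rw [add_sub_add_left_eq_sub, ← mul_sub, pow_add] at h1
    have hp0 : (p : ℤ_[p]) ^ (2 * e + 1) ≠ 0 := pow_ne_zero _ (by exact_mod_cast hp.ne_zero)
    have h2 := (mul_dvd_mul_iff_left hp0).1 h1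
    have h3 : ((((t ⟨j, hj⟩ : ℕ) : ℤ) - ((t' ⟨j, hj⟩ : ℕ) : ℤ) : ℤ) : ℤ_[p]) ∈
        Ideal.span {(p : ℤ_[p]) ^ M} := by
      rw [Ideal.mem_span_singleton]
      push_cast
      exact h2
    rw [← PadicInt.ker_toZModPow, RingHom.mem_ker, map_intCast] at h3
    push_cast at h3
    rw [sub_eq_zero, ZMod.natCast_eq_natCast_iff'] at h3
    rw [Nat.mod_eq_of_lt (t ⟨j, hj⟩).2, Nat.mod_eq_of_lt (t' ⟨j, hj⟩).2] at h3
    exact Fin.ext h3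

end LD

namespace LD

theorem partial_lower {n R p : ℕ} [Fact p.Prime] (hR : 0 < R) (hnR : R < n)
    (f : Fin R → MvPolynomial (Fin n) ℤ)
    (ν : Fin R → ℤ) (x₀ : Fin n → ℤ_[p]) (hsol : ∀ i, aeval x₀ (f i) = (ν i : ℤ_[p]))
    (I : Finset (Fin n)) (hI : I.card = R) (e : ℕ) (u₀ : ℤ_[p]ˣ)
    (hdet : aeval x₀ (jacMinor f I hI) = u₀ * (p : ℤ_[p]) ^ e) (M : ℕ) :
    (((p : ℝ) ^ (2 * e + 1)) ^ (n - R))⁻¹ ≤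
      (∑ r ∈ Finset.range (2 * e + 1 + M + 1), TT f ν p r).re := by
  classical
  have hp0 : (0 : ℝ) < p := by exact_mod_cast (Fact.out : p.Prime).pos
  have hc := hensel_count f ν x₀ hsol I hI e u₀ hdet M
  rw [partial_sum hR, GS_sum]
  set c := (Finset.univ.filter fun x : Fin n → ZMod (p ^ (2 * e + 1 + M)) =>
      ∀ i, eval x (map (Int.castRingHom _) (f i)) = (ν i : ZMod _)).card with hcdef
  set N := 2 * e + 1 + M with hN
  have h1 : ((p : ℂ) ^ (N * n))⁻¹ * (((p ^ N : ℕ) : ℂ) ^ R * (c : ℂ)) =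
      ((((p : ℝ) ^ (N * n))⁻¹ * (((p : ℝ) ^ N) ^ R * (c : ℝ)) : ℝ) : ℂ) := by
    push_cast; rfl
  have h2 : ((p : ℝ) ^ M) ^ (n - R) ≤ c := by
    rw [hcdef]
    exact_mod_cast hc
  obtain ⟨m, rfl⟩ : ∃ m, n = R + m := ⟨n - R, by omega⟩
  rw [Nat.add_sub_cancel_left] at h2 ⊢
  have h3 : (((p : ℝ) ^ (2 * e + 1)) ^ m)⁻¹ ≤
      ((p : ℝ) ^ (N * (R + m)))⁻¹ * (((p : ℝ) ^ N) ^ R * (c : ℝ)) := by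
    calc (((p : ℝ) ^ (2 * e + 1)) ^ m)⁻¹ =
        ((p : ℝ) ^ (N * (R + m)))⁻¹ * (((p : ℝ) ^ N) ^ R * ((p : ℝ) ^ M) ^ m) := by
          have h4 : (p : ℝ) ^ (N * (R + m)) = ((p : ℝ) ^ N) ^ R *
            (((p : ℝ) ^ (2 * e + 1)) ^ m * ((p : ℝ) ^ M) ^ m) := by
              rw [pow_mul, hN]; ring
          rw [h4]
          field_simp
      _ ≤ _ := by gcongr
  refine h3.trans (le_of_eq ?_)
  rw [← Complex.ofReal_re (_ * (_ * _)), ← h1]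

theorem main (n R d : ℕ) (hR : 0 < R) (hd : 2 ≤ d) (hnR : R < n)
    (f : Fin R → MvPolynomial (Fin n) ℤ) (hdeg : ∀ i, (f i).totalDegree = d)
    (K : ℝ)
    (hK : KofDelta n R d (fun i => MvPolynomial.homogeneousComponent d (f i)) K)
    (hKbig : BB R d < K)
    (p : ℕ) [Fact p.Prime] (ν : Fin R → ℤ) (x₀ : Fin n → ℤ_[p])
    (hsol : ∀ i, MvPolynomial.aeval x₀ (f i) = (ν i : ℤ_[p]))
    (hns : 0 < ⨆ I : {I : Finset (Fin n) // I.card = R},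
      ‖MvPolynomial.aeval x₀ (jacMinor f I.1 I.2)‖) :
    ((p : ℝ)⁻¹ * (⨆ I : {I : Finset (Fin n) // I.card = R},
        ‖MvPolynomial.aeval x₀ (jacMinor f I.1 I.2)‖) ^ 2) ^ (n - R) ≤
      (localDensity f ν p).re := by
  have hp0 : (0 : ℝ) < p := by exact_mod_cast (Fact.out : p.Prime).pos
  obtain ⟨D, rfl⟩ : ∃ D, d = D + 2 := ⟨d - 2, by omega⟩
  obtain ⟨Δ, hΔ, hKΔ⟩ := hK
  have hsum : Summable (TT f ν p) := by
    apply summable_TT (Δ := Δ) (D := D) hR f (fun i => (hdeg i).le)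
    · intro b hb
      rw [hΔ, birchDelta]
      exact le_iSup₂ (f := fun (b : Fin R → ℤ) (_ : b ≠ 0) =>
        singDim n (MvPolynomial.map (Int.castRingHom Qbar)
          (∑ i, b i • homogeneousComponent (D + 2) (f i)))) b hb
    · rw [hKΔ, BB, lt_div_iff₀ (by positivity)] at hKbig
      have h1 : D + 2 - 1 = D + 1 := by omega
      rw [h1] at hKbig
      have h2 : ((Δ + 2 ^ (D + 1) * (R * (R + 1) * (D + 1)) : ℕ) : ℝ) ≤ (n : ℝ) := by
        push_cast at hKbig ⊢
        nlinarith [hKbig]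
      exact_mod_cast h2
  have : Nonempty {I : Finset (Fin n) // I.card = R} := by
    by_contra hcon
    rw [not_nonempty_iff] at hcon
    rw [Real.iSup_of_isEmpty] at hns
    exact lt_irrefl _ hns
  obtain ⟨⟨I, hI⟩, hIeq⟩ := exists_eq_ciSup_of_finite
    (f := fun I : {I : Finset (Fin n) // I.card = R} =>
      ‖MvPolynomial.aeval x₀ (jacMinor f I.1 I.2)‖)
  rw [← hIeq] at hns ⊢
  simp only at hns ⊢
  have hne : aeval x₀ (jacMinor f I hI) ≠ 0 := norm_pos_iff.1 hns
  have hdet := PadicInt.unitCoeff_spec hne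
  set e := (aeval x₀ (jacMinor f I hI)).valuation
  have hnorm : ‖aeval x₀ (jacMinor f I hI)‖ = ((p : ℝ)⁻¹) ^ e := by
    rw [hdet, norm_mul, PadicInt.norm_units, one_mul, norm_pow, PadicInt.norm_p]
  have htend : Tendsto (fun M => (∑ r ∈ Finset.range (2 * e + 1 + M + 1), TT f ν p r).re) atTop
      (nhds (localDensity f ν p).re) := by
    have h1 := hsum.hasSum.tendsto_sum_nat
    have h2 : Tendsto (fun M : ℕ => 2 * e + 1 + M + 1) atTop atTop :=
      tendsto_atTop_mono (fun M => by show M ≤ _; omega) tendsto_id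
    exact (Complex.continuous_re.tendsto _).comp (h1.comp h2)
  refine ge_of_tendsto' htend (fun M => ?_)
  refine le_trans (le_of_eq ?_) (partial_lower hR hnR f ν x₀ hsol I hI e _ hdet M)
  rw [hnorm, ← inv_pow, ← inv_pow]
  congr 1
  rw [← pow_mul, mul_comm e 2, pow_succ, mul_comm]

end LD

/-- **Lemma 3.1 (lower bound for the local density at a non-singular `ℤ_p`-point).** -/
theorem local_density_lower_bound (n R d : ℕ) (hR : 0 < R) (hd : 2 ≤ d) (hnR : R < n)
    (f : Fin R → MvPolynomial (Fin n) ℤ) (hdeg : ∀ i, (f i).totalDegree = d)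
    (K : ℝ)
    (hK : KofDelta n R d (fun i => MvPolynomial.homogeneousComponent d (f i)) K)
    (hKbig : BB R d < K)
    (p : ℕ) [Fact p.Prime] (ν : Fin R → ℤ) (x₀ : Fin n → ℤ_[p])
    (hsol : ∀ i, MvPolynomial.aeval x₀ (f i) = (ν i : ℤ_[p]))
    (hns : 0 < ⨆ I : {I : Finset (Fin n) // I.card = R},
      ‖MvPolynomial.aeval x₀ (jacMinor f I.1 I.2)‖) :
    ((p : ℝ)⁻¹ * (⨆ I : {I : Finset (Fin n) // I.card = R},
        ‖MvPolynomial.aeval x₀ (jacMinor f I.1 I.2)‖) ^ 2) ^ (n - R) ≤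
      (localDensity f ν p).re := by
  exact LD.main n R d hR hd hnR f hdeg K hK hKbig p ν x₀ hsol hns

end
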